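/- arXiv:2111.12383 — 4 statements merged into one kernel-verified Lean document; each statement's English description precedes it below -/
import Mathlib

section
/- Gebelein's inequality: Let X and Y be independent standard Gaussian random variables on a probability space, let ρ ∈ [-1,1], and set ξ = X and η = ρ·X + √(1-ρ²)·Y (so that (ξ,η) is a centered Gaussian vector with E ξ² = E η² = 1 and correlation coefficient ρ). Then for all Borel measurable functions f, g : ℝ → ℝ such that E f(ξ)² < ∞, E g(η)² < ∞, E f(ξ) = 0 and E g(η) = 0, one has |E[f(ξ) g(η)]| ≤ |ρ| · (E f(ξ)²)^{1/2} · (E g(η)²)^{1/2}. -/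
open MeasureTheory ProbabilityTheory

/-- The Cauchy–Schwarz inequality in `L²`, in terms of integrals. -/
lemma abs_integral_mul_le_sqrt_mul_sqrt {α : Type*} [MeasurableSpace α] {μ : Measure α}
    {f g : α → ℝ} (hf : MemLp f 2 μ) (hg : MemLp g 2 μ) :
    |∫ x, f x * g x ∂μ| ≤ √(∫ x, f x ^ 2 ∂μ) * √(∫ x, g x ^ 2 ∂μ) := by
  have h := integral_mul_norm_le_Lp_mul_Lq (μ := μ) (f := f) (g := g) (p := 2) (q := 2)
    Real.HolderConjugate.two_two (by simpa using hf) (by simpa using hg)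
  rw [Real.sqrt_eq_rpow, Real.sqrt_eq_rpow]
  refine (abs_integral_le_integral_abs).trans ?_
  simpa [abs_mul] using h

lemma sqrt_integral_sq_eq_toReal_eLpNorm {α : Type*} [MeasurableSpace α] {μ : Measure α}
    {f : α → ℝ} (hf : MemLp f 2 μ) : √(∫ x, f x ^ 2 ∂μ) = (eLpNorm f 2 μ).toReal := by
  rw [hf.eLpNorm_eq_integral_rpow_norm (by simp) (by simp), ENNReal.toReal_ofReal (by positivity),
    Real.sqrt_eq_rpow]
  simp

/-- The product of two standard Gaussian measures is invariant under reflections. -/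
lemma measurePreserving_reflection_gaussianReal {ρ : ℝ} (hρ : ρ ∈ Set.Icc (-1 : ℝ) 1) :
    MeasurePreserving (fun p : ℝ × ℝ => (ρ * p.1 + √(1 - ρ ^ 2) * p.2,
        √(1 - ρ ^ 2) * p.1 - ρ * p.2))
      ((gaussianReal 0 1).prod (gaussianReal 0 1)) ((gaussianReal 0 1).prod (gaussianReal 0 1)) := by
  have hrot : MeasurePreserving (ContinuousLinearMap.rotation (E := ℝ) (Real.arccos ρ))
      ((gaussianReal 0 1).prod (gaussianReal 0 1)) ((gaussianReal 0 1).prod (gaussianReal 0 1)) :=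
    ⟨by fun_prop, IsGaussian.map_rotation_eq_self (by simp) _⟩
  have hneg : MeasurePreserving (fun x : ℝ => -x) (gaussianReal 0 1) (gaussianReal 0 1) :=
    ⟨by fun_prop, by simp [gaussianReal_map_neg]⟩
  convert! ((MeasurePreserving.id (gaussianReal 0 1)).prod hneg).comp hrot using 1
  ext p <;> simp [ContinuousLinearMap.rotation_apply, Real.cos_arccos hρ.1 hρ.2, Real.sin_arccos]
  ring

/-- A linear combination of two independent standard Gaussian variables has the same law as
a multiple of one of them. -/
lemma map_linear_comb_gaussianReal {a b c : ℝ} (h : a ^ 2 + b ^ 2 = c ^ 2) :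
    ((gaussianReal 0 1).prod (gaussianReal 0 1)).map (fun p : ℝ × ℝ => a * p.1 + b * p.2)
      = (gaussianReal 0 1).map (fun x => c * x) := by
  have ha := gaussianReal_map_const_mul (μ := 0) (v := 1) a
  have hb := gaussianReal_map_const_mul (μ := 0) (v := 1) b
  have hconv := gaussianReal_conv_gaussianReal (m₁ := a * 0) (m₂ := b * 0)
    (v₁ := .mk (a ^ 2) (sq_nonneg a) * 1) (v₂ := .mk (b ^ 2) (sq_nonneg b) * 1)
  rw [gaussianReal_map_const_mul]
  rw [← ha, ← hb, Measure.conv, Measure.map_prod_map _ _ (by fun_prop) (by fun_prop),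
    Measure.map_map (by fun_prop) (by fun_prop)] at hconv
  convert! hconv using 2
  · simp
  · ext; simp [h]

/-- The Ornstein–Uhlenbeck (noise) operator. -/
noncomputable def gaussianNoise (ρ : ℝ) (g : ℝ → ℝ) (x : ℝ) : ℝ :=
  ∫ y, g (ρ * x + √(1 - ρ ^ 2) * y) ∂gaussianReal 0 1

section GaussianNoise

variable {ρ B : ℝ} {L : NNReal} {f g : ℝ → ℝ}

lemma abs_gaussianNoise_le (hB : ∀ x, |g x| ≤ B) (x : ℝ) : |gaussianNoise ρ g x| ≤ B := by
  simpa [gaussianNoise] using norm_integral_le_of_norm_le_const (μ := gaussianReal 0 1)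
    (f := fun y => g (ρ * x + √(1 - ρ ^ 2) * y))
    (Filter.Eventually.of_forall fun y => hB (ρ * x + √(1 - ρ ^ 2) * y))

lemma measurable_gaussianNoise (hg : Measurable g) : Measurable (gaussianNoise ρ g) := by
  have : StronglyMeasurable (fun p : ℝ × ℝ => g (ρ * p.1 + √(1 - ρ ^ 2) * p.2)) :=
    Measurable.stronglyMeasurable (by fun_prop)
  exact this.integral_prod_right.measurable

lemma integral_mul_gaussianNoise (hf : Integrable f (gaussianReal 0 1)) (hg : Measurable g)
    (hB : ∀ x, |g x| ≤ B) :
    ∫ x, f x * gaussianNoise ρ g x ∂gaussianReal 0 1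
      = ∫ p : ℝ × ℝ, f p.1 * g (ρ * p.1 + √(1 - ρ ^ 2) * p.2)
          ∂(gaussianReal 0 1).prod (gaussianReal 0 1) := by
  rw [integral_prod]
  · simp_rw [integral_const_mul]; rfl
  · refine (hf.comp_fst _).mul_bdd (c := B) ?_ (Filter.Eventually.of_forall fun p => hB _)
    exact Measurable.aestronglyMeasurable (by fun_prop)

/-- The noise operator is self-adjoint. -/
lemma integral_mul_gaussianNoise_comm {B' : ℝ} (hρ : ρ ∈ Set.Icc (-1 : ℝ) 1) (hf : Measurable f)
    (hB' : ∀ x, |f x| ≤ B') (hg : Measurable g) (hB : ∀ x, |g x| ≤ B) :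
    ∫ x, f x * gaussianNoise ρ g x ∂gaussianReal 0 1
      = ∫ x, g x * gaussianNoise ρ f x ∂gaussianReal 0 1 := by
  rw [integral_mul_gaussianNoise (.of_bound hf.aestronglyMeasurable B' (.of_forall hB')) hg hB,
    integral_mul_gaussianNoise (.of_bound hg.aestronglyMeasurable B (.of_forall hB)) hf hB']
  have hR := measurePreserving_reflection_gaussianReal hρ
  rw [← hR.map_eq, integral_map (by fun_prop) (Measurable.aestronglyMeasurable (by fun_prop)),
    hR.map_eq]
  refine integral_congr_ae (.of_forall fun p => ?_)
  have hs : √(1 - ρ ^ 2) ^ 2 = 1 - ρ ^ 2 := Real.sq_sqrt (by nlinarith [hρ.1, hρ.2])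
  have : ρ * (ρ * p.1 + √(1 - ρ ^ 2) * p.2) + √(1 - ρ ^ 2) * (√(1 - ρ ^ 2) * p.1 - ρ * p.2)
      = p.1 := by linear_combination p.1 * hs
  simp only [this]
  exact mul_comm _ _

/-- The semigroup property of the noise operator. -/
lemma gaussianNoise_gaussianNoise (hρ : ρ ∈ Set.Icc (-1 : ℝ) 1) (hg : Measurable g)
    (hB : ∀ x, |g x| ≤ B) : gaussianNoise ρ (gaussianNoise ρ g) = gaussianNoise (ρ ^ 2) g := by
  ext x
  have hs : √(1 - ρ ^ 2) ^ 2 = 1 - ρ ^ 2 := Real.sq_sqrt (by nlinarith [hρ.1, hρ.2])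
  have hs' : √(1 - (ρ ^ 2) ^ 2) ^ 2 = 1 - (ρ ^ 2) ^ 2 :=
    Real.sq_sqrt (by nlinarith [sq_nonneg ρ, hρ.1, hρ.2])
  have hlaw := map_linear_comb_gaussianReal (a := ρ * √(1 - ρ ^ 2)) (b := √(1 - ρ ^ 2))
    (c := √(1 - (ρ ^ 2) ^ 2)) (by rw [hs', mul_pow, hs]; ring)
  have hmeas : Measurable fun z => g (ρ ^ 2 * x + z) := by fun_prop
  have h := congrArg (fun μ => ∫ z, g (ρ ^ 2 * x + z) ∂μ) hlaw
  rw [integral_map (by fun_prop) hmeas.aestronglyMeasurable,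
    integral_map (by fun_prop) hmeas.aestronglyMeasurable, integral_prod] at h
  · refine Eq.trans ?_ h
    simp only [gaussianNoise]
    congr! 5
    ring
  · exact .of_bound (Measurable.aestronglyMeasurable (by fun_prop)) B (.of_forall fun _ => hB _)

lemma integral_gaussianNoise_sq (hρ : ρ ∈ Set.Icc (-1 : ℝ) 1) (hg : Measurable g)
    (hB : ∀ x, |g x| ≤ B) :
    ∫ x, gaussianNoise ρ g x ^ 2 ∂gaussianReal 0 1
      = ∫ x, g x * gaussianNoise (ρ ^ 2) g x ∂gaussianReal 0 1 := by
  rw [← gaussianNoise_gaussianNoise hρ hg hB, integral_mul_gaussianNoise_comm hρ hg hB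
    (measurable_gaussianNoise hg) (abs_gaussianNoise_le hB)]
  simp only [sq]

lemma abs_gaussianNoise_le_of_lipschitzWith (hρ : ρ ∈ Set.Icc (-1 : ℝ) 1) (hL : LipschitzWith L g)
    (hB : ∀ x, |g x| ≤ B) (h0 : ∫ x, g x ∂gaussianReal 0 1 = 0) (x : ℝ) :
    |gaussianNoise ρ g x| ≤ L * |ρ| * (|x| + ∫ y, |y| ∂gaussianReal 0 1) := by
  have hgm : Measurable g := hL.continuous.measurable
  have hid : Integrable (fun y : ℝ => |y|) (gaussianReal 0 1) :=
    ((memLp_id_gaussianReal' (μ := 0) (v := 1) 1 (by simp)).integrable le_rfl).abs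
  have hs : √(1 - ρ ^ 2) ^ 2 = 1 - ρ ^ 2 := Real.sq_sqrt (by nlinarith [hρ.1, hρ.2])
  have hs0 := Real.sqrt_nonneg (1 - ρ ^ 2)
  have hρ1 : |ρ| ≤ 1 := abs_le.2 hρ
  have hs1 : √(1 - ρ ^ 2) ≤ 1 := by nlinarith [sq_nonneg ρ]
  have hs2 : |√(1 - ρ ^ 2) - 1| ≤ |ρ| := by
    rw [abs_sub_comm, abs_of_nonneg (by linarith)]
    nlinarith [sq_abs ρ, abs_nonneg ρ]
  have heq : gaussianNoise ρ g x
      = ∫ y, (g (ρ * x + √(1 - ρ ^ 2) * y) - g y) ∂gaussianReal 0 1 := by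
    rw [integral_sub, h0, sub_zero]
    · rfl
    · exact .of_bound (Measurable.aestronglyMeasurable (by fun_prop)) B (.of_forall fun _ => hB _)
    · exact .of_bound hgm.aestronglyMeasurable B (.of_forall fun _ => hB _)
  rw [heq]
  have hrhs : L * |ρ| * (|x| + ∫ y, |y| ∂gaussianReal 0 1)
      = ∫ y, L * |ρ| * (|x| + |y|) ∂gaussianReal 0 1 := by
    rw [integral_const_mul, integral_add (integrable_const _) hid]; simp
  rw [hrhs, ← Real.norm_eq_abs]
  refine norm_integral_le_of_norm_le (((integrable_const _).add hid).const_mul _) (.of_forall fun y => ?_)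
  have h1 := hL.dist_le_mul (ρ * x + √(1 - ρ ^ 2) * y) y
  rw [Real.dist_eq, Real.dist_eq] at h1
  refine h1.trans ?_
  rw [mul_assoc]
  gcongr
  calc |ρ * x + √(1 - ρ ^ 2) * y - y| = |ρ * x + (√(1 - ρ ^ 2) - 1) * y| := by ring_nf
    _ ≤ |ρ * x| + |(√(1 - ρ ^ 2) - 1) * y| := abs_add_le _ _
    _ ≤ |ρ| * |x| + |ρ| * |y| := by rw [abs_mul, abs_mul]; gcongr
    _ = _ := by ring

lemma exists_integral_gaussianNoise_sq_le (hL : LipschitzWith L g)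
    (hB : ∀ x, |g x| ≤ B) (h0 : ∫ x, g x ∂gaussianReal 0 1 = 0) :
    ∃ C, ∀ ρ ∈ Set.Icc (-1 : ℝ) 1, ∫ x, gaussianNoise ρ g x ^ 2 ∂gaussianReal 0 1 ≤ C * ρ ^ 2 := by
  set M := ∫ y, |y| ∂gaussianReal 0 1
  refine ⟨L ^ 2 * ∫ x, (|x| + M) ^ 2 ∂gaussianReal 0 1, fun ρ hρ => ?_⟩
  have hint : Integrable (fun x : ℝ => (|x| + M) ^ 2) (gaussianReal 0 1) :=
    MemLp.integrable_sq
      ((memLp_id_gaussianReal' (μ := 0) (v := 1) 2 (by simp)).abs.add (memLp_const M))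
  calc ∫ x, gaussianNoise ρ g x ^ 2 ∂gaussianReal 0 1
      ≤ ∫ x, (L * |ρ|) ^ 2 * (|x| + M) ^ 2 ∂gaussianReal 0 1 := by
        refine integral_mono_of_nonneg (.of_forall fun x => sq_nonneg _) (hint.const_mul _)
          (.of_forall fun x => ?_)
        simp only
        rw [← mul_pow, ← sq_abs]
        gcongr
        exact abs_gaussianNoise_le_of_lipschitzWith hρ hL hB h0 x
    _ = _ := by rw [integral_const_mul, mul_pow, sq_abs]; ring

/-- A function with `a t ^ 2 ≤ N * a (t ^ 2)` and `a t = O(t ^ 2)` satisfies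
`a t ≤ N * t ^ 2`. -/
lemma le_mul_sq_of_sq_le_mul {a : ℝ → ℝ} {N C : ℝ} (hN : 0 ≤ N)
    (hsq : ∀ t ∈ Set.Icc (-1 : ℝ) 1, a t ^ 2 ≤ N * a (t ^ 2))
    (hC : ∀ t ∈ Set.Icc (-1 : ℝ) 1, a t ≤ C * t ^ 2) {t : ℝ}
    (ht : t ∈ Set.Icc (-1 : ℝ) 1) : a t ≤ N * t ^ 2 := by
  by_contra! hlt
  have ha : 0 < a t := lt_of_le_of_lt (by positivity) hlt
  have hN0 : 0 < N := by
    refine lt_of_le_of_ne hN fun h => ?_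
    have := hsq t ht
    rw [← h] at this
    nlinarith
  have ht0 : 0 < t ^ 2 := by
    have := hC t ht
    refine lt_of_le_of_ne (sq_nonneg t) fun h => ?_
    rw [← h] at this
    linarith
  have hmem (k : ℕ) : t ^ k ∈ Set.Icc (-1 : ℝ) 1 := by
    rw [Set.mem_Icc, ← abs_le, abs_pow]
    exact pow_le_one₀ (abs_nonneg _) (abs_le.2 ht)
  have hiter (k : ℕ) : (a t / N) ^ 2 ^ k ≤ a (t ^ 2 ^ k) / N := by
    induction k with
    | zero => simp
    | succ k ih =>
      have h1 := hsq _ (hmem (2 ^ k))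
      rw [pow_succ 2 k, pow_mul, pow_mul]
      calc ((a t / N) ^ 2 ^ k) ^ 2 ≤ (a (t ^ 2 ^ k) / N) ^ 2 := by gcongr
        _ ≤ a ((t ^ 2 ^ k) ^ 2) / N := by
          rw [div_pow, div_le_div_iff₀ (by positivity) hN0]
          nlinarith
  have hr : 1 < a t / N / t ^ 2 := by
    rw [div_div, one_lt_div (by positivity)]; exact hlt
  obtain ⟨k, hk⟩ := pow_unbounded_of_one_lt (C / N) hr
  have hk' : C / N < (a t / N / t ^ 2) ^ 2 ^ k :=
    hk.trans_le (pow_le_pow_right₀ hr.le Nat.lt_two_pow_self.le)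
  rw [div_pow, lt_div_iff₀ (by positivity)] at hk'
  have h2 := hiter k
  have h3 : a (t ^ 2 ^ k) / N ≤ C * (t ^ 2 ^ k) ^ 2 / N := by gcongr; exact hC _ (hmem _)
  have h4 : C * (t ^ 2 ^ k) ^ 2 / N = C / N * (t ^ 2) ^ 2 ^ k := by rw [pow_right_comm]; ring
  linarith

/-- The noise operator contracts centered functions by the factor `|ρ|`. -/
lemma integral_gaussianNoise_sq_le (hρ : ρ ∈ Set.Icc (-1 : ℝ) 1) (hL : LipschitzWith L g)
    (hB : ∀ x, |g x| ≤ B) (h0 : ∫ x, g x ∂gaussianReal 0 1 = 0) :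
    ∫ x, gaussianNoise ρ g x ^ 2 ∂gaussianReal 0 1 ≤ (∫ x, g x ^ 2 ∂gaussianReal 0 1) * ρ ^ 2 := by
  have hg : Measurable g := hL.continuous.measurable
  obtain ⟨C, hC⟩ := exists_integral_gaussianNoise_sq_le hL hB h0
  refine le_mul_sq_of_sq_le_mul (a := fun t => ∫ x, gaussianNoise t g x ^ 2 ∂gaussianReal 0 1)
    (integral_nonneg fun _ => sq_nonneg _) (fun t ht => ?_) hC hρ
  have hcs := abs_integral_mul_le_sqrt_mul_sqrt (μ := gaussianReal 0 1)
    (.of_bound hg.aestronglyMeasurable B (.of_forall hB))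
    (.of_bound (measurable_gaussianNoise (ρ := t ^ 2) hg).aestronglyMeasurable B
      (.of_forall (abs_gaussianNoise_le hB)))
  simp only
  rw [integral_gaussianNoise_sq ht hg hB, ← sq_abs]
  refine (pow_le_pow_left₀ (abs_nonneg _) hcs 2).trans_eq ?_
  rw [mul_pow, Real.sq_sqrt (integral_nonneg fun _ => sq_nonneg _),
    Real.sq_sqrt (integral_nonneg fun _ => sq_nonneg _)]

lemma abs_integral_mul_gaussianNoise_le (hρ : ρ ∈ Set.Icc (-1 : ℝ) 1)
    (hf : MemLp f 2 (gaussianReal 0 1)) (hf0 : ∫ x, f x ∂gaussianReal 0 1 = 0)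
    (hL : LipschitzWith L g) (hB : ∀ x, |g x| ≤ B) :
    |∫ x, f x * gaussianNoise ρ g x ∂gaussianReal 0 1|
      ≤ |ρ| * √(∫ x, f x ^ 2 ∂gaussianReal 0 1) * √(∫ x, g x ^ 2 ∂gaussianReal 0 1) := by
  have hg : Measurable g := hL.continuous.measurable
  have hg2 : MemLp g 2 (gaussianReal 0 1) := .of_bound hg.aestronglyMeasurable B (.of_forall hB)
  have hgi : Integrable g (gaussianReal 0 1) := hg2.integrable (by norm_num)
  set m := ∫ x, g x ∂gaussianReal 0 1 with hm
  have hLm : LipschitzWith L (fun x => g x - m) := by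
    simpa using hL.sub (LipschitzWith.const m)
  have hBm (x : ℝ) : |g x - m| ≤ B + |m| := (abs_sub _ _).trans (by gcongr; exact hB x)
  have h0m : ∫ x, (g x - m) ∂gaussianReal 0 1 = 0 := by
    rw [integral_sub hgi (integrable_const _)]; simp [hm]
  have hnoise (x : ℝ) : gaussianNoise ρ (fun x => g x - m) x = gaussianNoise ρ g x - m := by
    unfold gaussianNoise
    rw [integral_sub _ (integrable_const _)]
    · simp
    · exact .of_bound (Measurable.aestronglyMeasurable (by fun_prop)) B (.of_forall fun _ => hB _)
  have hTg : MemLp (gaussianNoise ρ g) 2 (gaussianReal 0 1) :=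
    .of_bound (measurable_gaussianNoise hg).aestronglyMeasurable B
      (.of_forall (abs_gaussianNoise_le hB))
  have heq : ∫ x, f x * gaussianNoise ρ g x ∂gaussianReal 0 1
      = ∫ x, f x * gaussianNoise ρ (fun x => g x - m) x ∂gaussianReal 0 1 := by
    simp_rw [hnoise, mul_sub]
    rw [integral_sub (f := fun x => f x * gaussianNoise ρ g x) (hf.integrable_mul hTg)
      ((hf.integrable (by norm_num)).mul_const _),
      integral_mul_const, hf0]
    simp
  have hvar : ∫ x, (g x - m) ^ 2 ∂gaussianReal 0 1 ≤ ∫ x, g x ^ 2 ∂gaussianReal 0 1 := by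
    rw [hm, ← variance_eq_integral hg.aemeasurable]
    exact variance_le_expectation_sq hg.aestronglyMeasurable
  have hTm : MemLp (gaussianNoise ρ fun x => g x - m) 2 (gaussianReal 0 1) :=
    .of_bound (measurable_gaussianNoise (by fun_prop)).aestronglyMeasurable (B + |m|)
      (.of_forall (abs_gaussianNoise_le hBm))
  rw [heq]
  refine (abs_integral_mul_le_sqrt_mul_sqrt hf hTm).trans ?_
  have hle : √(∫ x, gaussianNoise ρ (fun x => g x - m) x ^ 2 ∂gaussianReal 0 1)
      ≤ √(∫ x, g x ^ 2 ∂gaussianReal 0 1) * |ρ| := by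
    rw [← Real.sqrt_sq_eq_abs, ← Real.sqrt_mul (integral_nonneg fun _ => sq_nonneg _)]
    refine Real.sqrt_le_sqrt ((integral_gaussianNoise_sq_le hρ hLm hBm h0m).trans ?_)
    gcongr
  calc _ ≤ √(∫ x, f x ^ 2 ∂gaussianReal 0 1) * (√(∫ x, g x ^ 2 ∂gaussianReal 0 1) * |ρ|) := by
        gcongr
    _ = _ := by ring

lemma measurePreserving_correlated_gaussianReal (hρ : ρ ∈ Set.Icc (-1 : ℝ) 1) :
    MeasurePreserving (fun p : ℝ × ℝ => ρ * p.1 + √(1 - ρ ^ 2) * p.2)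
      ((gaussianReal 0 1).prod (gaussianReal 0 1)) (gaussianReal 0 1) :=
  measurePreserving_fst.comp (measurePreserving_reflection_gaussianReal hρ)

/-- Gebelein's inequality for the product of two standard Gaussian measures. -/
lemma abs_integral_mul_correlated_le (hρ : ρ ∈ Set.Icc (-1 : ℝ) 1)
    (hf : MemLp f 2 (gaussianReal 0 1)) (hf0 : ∫ x, f x ∂gaussianReal 0 1 = 0)
    (hg : MemLp g 2 (gaussianReal 0 1)) :
    |∫ p : ℝ × ℝ, f p.1 * g (ρ * p.1 + √(1 - ρ ^ 2) * p.2)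
        ∂(gaussianReal 0 1).prod (gaussianReal 0 1)|
      ≤ |ρ| * √(∫ x, f x ^ 2 ∂gaussianReal 0 1) * √(∫ x, g x ^ 2 ∂gaussianReal 0 1) := by
  set μ := gaussianReal 0 1
  have hη : MeasurePreserving (fun p : ℝ × ℝ => ρ * p.1 + √(1 - ρ ^ 2) * p.2) (μ.prod μ) μ :=
    measurePreserving_correlated_gaussianReal hρ
  set F := √(∫ x, f x ^ 2 ∂μ)
  set G := √(∫ x, g x ^ 2 ∂μ)
  have happrox (ε : ℝ) (hε : 0 < ε) :
      |∫ p : ℝ × ℝ, f p.1 * g (ρ * p.1 + √(1 - ρ ^ 2) * p.2) ∂μ.prod μ|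
        ≤ |ρ| * F * (G + ε) + F * ε := by
    obtain ⟨h, hsupp, hsmooth, happ⟩ := hg.exist_eLpNorm_sub_le (by simp) (by norm_num) hε
    obtain ⟨L, hL⟩ := hsmooth.lipschitzWith_of_hasCompactSupport hsupp (by simp)
    obtain ⟨B, hB⟩ := hsupp.exists_bound_of_continuous hL.continuous
    have hh : MemLp h 2 μ := .of_bound hL.continuous.aestronglyMeasurable B (.of_forall hB)
    have hd : √(∫ x, (g x - h x) ^ 2 ∂μ) ≤ ε := by
      refine (sqrt_integral_sq_eq_toReal_eLpNorm (hg.sub hh)).trans_le ?_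
      exact ENNReal.toReal_le_of_le_ofReal hε.le happ
    have hhG : √(∫ x, h x ^ 2 ∂μ) ≤ G + ε := by
      have h1 : eLpNorm h 2 μ ≤ eLpNorm g 2 μ + eLpNorm (g - h) 2 μ := by
        simpa using eLpNorm_sub_le hg.1 (hg.sub hh).1 (p := 2) (by norm_num)
      have h2 := ENNReal.toReal_mono (by finiteness [hg.2.ne, (hg.sub hh).2.ne]) h1
      rw [ENNReal.toReal_add hg.2.ne (hg.sub hh).2.ne, ← sqrt_integral_sq_eq_toReal_eLpNorm hh,
        ← sqrt_integral_sq_eq_toReal_eLpNorm hg,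
        ← sqrt_integral_sq_eq_toReal_eLpNorm (hg.sub hh)] at h2
      exact h2.trans (by gcongr; exact hd)
    have hfst : MeasurePreserving (Prod.fst : ℝ × ℝ → ℝ) (μ.prod μ) μ := measurePreserving_fst
    have hf' := hf.comp_measurePreserving hfst
    have hh' := hh.comp_measurePreserving hη
    have hd' := (hg.sub hh).comp_measurePreserving hη
    have hsplit : ∫ p : ℝ × ℝ, f p.1 * g (ρ * p.1 + √(1 - ρ ^ 2) * p.2) ∂μ.prod μ
        = ∫ x, f x * gaussianNoise ρ h x ∂μ
          + ∫ p : ℝ × ℝ, f p.1 * (g - h) (ρ * p.1 + √(1 - ρ ^ 2) * p.2) ∂μ.prod μ := by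
      rw [integral_mul_gaussianNoise (hf.integrable (by norm_num)) hL.continuous.measurable hB]
      refine Eq.trans ?_ (integral_add (hf'.integrable_mul hh') (hf'.integrable_mul hd'))
      refine integral_congr_ae (.of_forall fun p => ?_)
      simp; ring
    have hrem := abs_integral_mul_le_sqrt_mul_sqrt hf' hd'
    have e1 : ∫ p, (f ∘ Prod.fst) p ^ 2 ∂μ.prod μ = ∫ x, f x ^ 2 ∂μ := by
      conv_rhs => rw [← hfst.map_eq]
      rw [integral_map (by fun_prop) (by rw [hfst.map_eq]; exact hf.1.pow 2)]
      rfl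
    have e2 : ∫ p, ((g - h) ∘ fun p : ℝ × ℝ => ρ * p.1 + √(1 - ρ ^ 2) * p.2) p ^ 2 ∂μ.prod μ
        = ∫ x, (g x - h x) ^ 2 ∂μ := by
      conv_rhs => rw [← hη.map_eq]
      rw [integral_map (by fun_prop) (by rw [hη.map_eq]; exact (hg.sub hh).1.pow 2)]
      rfl
    rw [e1, e2] at hrem
    rw [hsplit]
    refine (abs_add_le _ _).trans (add_le_add ?_ (hrem.trans (by gcongr)))
    exact (abs_integral_mul_gaussianNoise_le hρ hf hf0 hL hB).trans (by gcongr)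
  have hlim : Filter.Tendsto (fun ε => |ρ| * F * (G + ε) + F * ε) (nhdsWithin 0 (Set.Ioi 0))
      (nhds (|ρ| * F * G)) := by
    have : Continuous fun ε => |ρ| * F * (G + ε) + F * ε := by fun_prop
    simpa using (this.tendsto 0).mono_left nhdsWithin_le_nhds
  exact ge_of_tendsto hlim (eventually_nhdsWithin_of_forall happrox)

end GaussianNoise

/-- **Gebelein's inequality.** If `X, Y` are independent standard Gaussian random variables,
`ρ ∈ [-1, 1]`, `ξ = X` and `η = ρ X + √(1 - ρ²) Y`, then for all Borel measurable
`f g : ℝ → ℝ` with `E f(ξ)² < ∞`, `E g(η)² < ∞`, `E f(ξ) = 0`, `E g(η) = 0` one has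
`|E[f(ξ) g(η)]| ≤ |ρ| (E f(ξ)²)^{1/2} (E g(η)²)^{1/2}`. -/
theorem gebelein_inequality
    {Ω : Type*} [MeasurableSpace Ω] (P : Measure Ω) [IsProbabilityMeasure P]
    (X Y : Ω → ℝ) (hX : Measurable X) (hY : Measurable Y)
    (hXY : IndepFun X Y P)
    (hXlaw : P.map X = gaussianReal 0 1) (hYlaw : P.map Y = gaussianReal 0 1)
    (ρ : ℝ) (hρ : ρ ∈ Set.Icc (-1 : ℝ) 1)
    (ξ η : Ω → ℝ) (hξ : ξ = X)
    (hη : η = fun ω => ρ * X ω + Real.sqrt (1 - ρ ^ 2) * Y ω)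
    (f g : ℝ → ℝ) (hf : Measurable f) (hg : Measurable g)
    (hf2 : Integrable (fun ω => (f (ξ ω)) ^ 2) P)
    (hg2 : Integrable (fun ω => (g (η ω)) ^ 2) P)
    (hfmean : ∫ ω, f (ξ ω) ∂P = 0) (hgmean : ∫ ω, g (η ω) ∂P = 0) :
    |∫ ω, f (ξ ω) * g (η ω) ∂P| ≤
      |ρ| * Real.sqrt (∫ ω, (f (ξ ω)) ^ 2 ∂P) * Real.sqrt (∫ ω, (g (η ω)) ^ 2 ∂P) := by
  subst hξ
  have hpair : MeasurePreserving (fun ω => (ξ ω, Y ω)) P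
      ((gaussianReal 0 1).prod (gaussianReal 0 1)) := by
    refine ⟨by fun_prop, ?_⟩
    rw [(indepFun_iff_map_prod_eq_prod_map_map hX.aemeasurable hY.aemeasurable).1 hXY, hXlaw, hYlaw]
  have hξP : MeasurePreserving ξ P (gaussianReal 0 1) := ⟨hX, hXlaw⟩
  have hηP : MeasurePreserving η P (gaussianReal 0 1) := by
    rw [hη]; exact (measurePreserving_correlated_gaussianReal hρ).comp hpair
  have hfL : MemLp f 2 (gaussianReal 0 1) := by
    rw [memLp_two_iff_integrable_sq hf.aestronglyMeasurable]
    exact (hξP.integrable_comp (by fun_prop)).1 hf2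
  have hgL : MemLp g 2 (gaussianReal 0 1) := by
    rw [memLp_two_iff_integrable_sq hg.aestronglyMeasurable]
    exact (hηP.integrable_comp (by fun_prop)).1 hg2
  have hcomp {T : Ω → ℝ} (hT : MeasurePreserving T P (gaussianReal 0 1)) {u : ℝ → ℝ}
      (hu : Measurable u) : ∫ ω, u (T ω) ∂P = ∫ x, u x ∂gaussianReal 0 1 := by
    rw [← hT.map_eq, integral_map hT.measurable.aemeasurable hu.aestronglyMeasurable]
  have hprod : ∫ ω, f (ξ ω) * g (η ω) ∂P
      = ∫ p : ℝ × ℝ, f p.1 * g (ρ * p.1 + √(1 - ρ ^ 2) * p.2)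
          ∂(gaussianReal 0 1).prod (gaussianReal 0 1) := by
    rw [← hpair.map_eq, integral_map hpair.measurable.aemeasurable
      (Measurable.aestronglyMeasurable (by fun_prop)), hη]
  rw [hprod, hcomp hξP (hf.pow_const 2), hcomp hηP (hg.pow_const 2)]
  exact abs_integral_mul_correlated_le hρ hfL ((hcomp hξP hf).symm.trans hfmean) hgL
end

section
/- Let n ≥ 1 be an integer, β₁ ∈ ℝ, β₂ ∈ (1 − 1/n, 1), κ > 0, and suppose α := β₁ + (n/2)(β₂ − 1) + 1 satisfies 0 < α < 1. Let K : (0, ∞) → ℝ be measurable with |K(u)| ≤ κ·u^{β₂−1} for all u > 0. Then there is a constant C, depending only on n, β₁ and β₂, such that for all s > 0: ∫_{ℝ} ∫_{ℝ} |k_s^{β₁}(u)| |k_s^{β₁}(v)| |K(|u − v|)|^n du dv ≤ C · κ^n · s^{2α} (in particular the double integral is finite). -/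
open MeasureTheory

/-- The fractional kernel `k_t^{β₁}`: `k_t^0 = 1_{(0,t]}` and
`k_t^{β₁}(u) = (1/β₁)[((t−u)₊)^{β₁} − ((−u)₊)^{β₁}]` for `β₁ ≠ 0`. -/
noncomputable def fracKernel (β₁ t u : ℝ) : ℝ :=
  if β₁ = 0 then Set.indicator (Set.Ioc 0 t) (fun _ => (1 : ℝ)) u
  else (1 / β₁) * ((max (t - u) 0) ^ β₁ - (max (-u) 0) ^ β₁)

/-- The function supported on `(0, ∞)` that equals `x ^ p` on `(0, 1]` and `x ^ q` on `(1, ∞)`. -/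
noncomputable def rpowProfile (p q x : ℝ) : ℝ :=
  if x ≤ 0 then 0 else if x ≤ 1 then x ^ p else x ^ q

lemma rpowProfile_nonneg (p q x : ℝ) : 0 ≤ rpowProfile p q x := by
  unfold rpowProfile
  split_ifs with h₀ h₁
  · exact le_rfl
  · exact Real.rpow_nonneg (not_le.1 h₀).le _
  · exact Real.rpow_nonneg (not_le.1 h₀).le _

lemma rpowProfile_of_le_one {p q x : ℝ} (h₀ : 0 < x) (h₁ : x ≤ 1) :
    rpowProfile p q x = x ^ p := by
  simp [rpowProfile, h₀.not_ge, h₁]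

lemma rpowProfile_of_one_lt {p q x : ℝ} (h₁ : 1 < x) : rpowProfile p q x = x ^ q := by
  simp [rpowProfile, (zero_lt_one.trans h₁).not_ge, h₁.not_ge]

@[fun_prop]
lemma measurable_rpowProfile (p q : ℝ) : Measurable (rpowProfile p q) := by
  unfold rpowProfile
  refine Measurable.ite measurableSet_Iic measurable_const ?_
  exact Measurable.ite measurableSet_Iic (by fun_prop) (by fun_prop)

lemma lintegral_rpowProfile_ne_top {p q : ℝ} (hp : -1 < p) (hq : q < -1) :
    ∫⁻ x, ENNReal.ofReal (rpowProfile p q x) ≠ ⊤ := by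
  have h₁ : IntegrableOn (fun x : ℝ => x ^ p) (Set.Ioc 0 1) := by
    rw [← intervalIntegrable_iff_integrableOn_Ioc_of_le zero_le_one]
    exact intervalIntegral.intervalIntegrable_rpow' hp
  have h₂ : IntegrableOn (fun x : ℝ => x ^ q) (Set.Ioi 1) :=
    integrableOn_Ioi_rpow_of_lt hq zero_lt_one
  have h : rpowProfile p q = fun x => (Set.Ioc 0 1).indicator (fun x : ℝ => x ^ p) x
      + (Set.Ioi 1).indicator (fun x : ℝ => x ^ q) x := by
    funext x
    rcases le_or_gt x 0 with h0 | h0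
    · have : ¬ 1 < x := by linarith
      simp [rpowProfile, h0, h0.not_gt, this]
    · rcases le_or_gt x 1 with h1 | h1
      · simp [rpowProfile_of_le_one h0 h1, h0, h1, h1.not_gt]
      · simp [rpowProfile_of_one_lt h1, h1, h1.not_ge]
  have hint : Integrable (rpowProfile p q) := by
    rw [h]
    exact ((integrable_indicator_iff measurableSet_Ioc).2 h₁).add
      ((integrable_indicator_iff measurableSet_Ioi).2 h₂)
  exact hint.lintegral_lt_top.ne

lemma lintegral_comp_div_right {f : ℝ → ENNReal} (hf : Measurable f) {ρ : ℝ} (hρ : 0 < ρ) :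
    ∫⁻ x, f (x / ρ) = ENNReal.ofReal ρ * ∫⁻ x, f x := by
  have h : ∀ x : ℝ, x / ρ = ρ⁻¹ * x := fun x => by rw [div_eq_mul_inv, mul_comm]
  simp_rw [h]
  rw [← lintegral_map hf (measurable_const_mul ρ⁻¹),
    Real.map_volume_mul_left (inv_pos.2 hρ).ne', lintegral_smul_measure, inv_inv,
    abs_of_pos hρ, smul_eq_mul]

lemma lintegral_rpowProfile_abs_sub_div_le (p q c : ℝ) {ρ : ℝ} (hρ : 0 < ρ) :
    ∫⁻ x, ENNReal.ofReal (rpowProfile p q (|x - c| / ρ)) ≤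
      ENNReal.ofReal ρ * (2 * ∫⁻ x, ENNReal.ofReal (rpowProfile p q x)) := by
  rw [lintegral_sub_right_eq_self (fun x => ENNReal.ofReal (rpowProfile p q (|x| / ρ))) c]
  calc
    _ ≤ ∫⁻ x, (ENNReal.ofReal (rpowProfile p q (x / ρ))
          + ENNReal.ofReal (rpowProfile p q (-x / ρ))) := by
        refine lintegral_mono fun x => ?_
        rcases abs_cases x with ⟨h, -⟩ | ⟨h, -⟩ <;> simp only [h]
        · exact le_self_add
        · exact le_add_self
    _ = _ := by
        rw [lintegral_add_left (by fun_prop),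
          lintegral_neg_eq_self (fun x => ENNReal.ofReal (rpowProfile p q (x / ρ))),
          lintegral_comp_div_right (f := fun x => ENNReal.ofReal (rpowProfile p q x))
            (by fun_prop) hρ]
        ring

lemma rpow_neg_mul_rpow_neg_le {a b x y ρ : ℝ} (hb : 0 ≤ b) (hρ : 0 < ρ) (hx : 0 < x)
    (hxy : x ≤ y) (h : 2 * ρ ≤ x + y) :
    x ^ (-a) * y ^ (-b) ≤ ρ ^ (-a - b) * rpowProfile (-a) (-a - b) (x / ρ) := by
  have hρy : ρ ≤ y := by linarith
  rcases le_or_gt x ρ with hle | hlt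
  · rw [rpowProfile_of_le_one (div_pos hx hρ) ((div_le_one hρ).2 hle), Real.div_rpow hx.le hρ.le,
      Real.rpow_sub hρ]
    have := Real.rpow_le_rpow_of_nonpos hρ hρy (neg_nonpos.2 hb)
    have h0 := Real.rpow_pos_of_pos hρ (-a)
    have h1 := Real.rpow_pos_of_pos hx (-a)
    rw [Real.rpow_neg hρ.le b] at this
    calc _ ≤ x ^ (-a) * (ρ ^ b)⁻¹ := by gcongr
      _ = _ := by field_simp
  · rw [rpowProfile_of_one_lt ((one_lt_div hρ).2 hlt), Real.div_rpow hx.le hρ.le,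
      mul_div_cancel₀ _ (Real.rpow_pos_of_pos hρ _).ne', sub_eq_add_neg, Real.rpow_add hx]
    have := Real.rpow_le_rpow_of_nonpos hx hxy (neg_nonpos.2 hb)
    gcongr

lemma abs_rpow_neg_mul_abs_rpow_neg_le {a b c u v : ℝ} (ha : 0 < a) (hb : 0 < b) (hu : u ≠ c) :
    |v - c| ^ (-a) * |u - v| ^ (-b) ≤ (|u - c| / 2) ^ (-a - b) *
      (rpowProfile (-a) (-a - b) (|v - c| / (|u - c| / 2)) +
        rpowProfile (-b) (-a - b) (|v - u| / (|u - c| / 2))) := by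
  have hρ : 0 < |u - c| / 2 := by have := abs_pos.2 (sub_ne_zero.2 hu); positivity
  have htri : 2 * (|u - c| / 2) ≤ |v - c| + |u - v| := by
    have := abs_add_le (u - v) (v - c)
    rw [sub_add_sub_cancel] at this
    linarith
  rw [abs_sub_comm v u]
  generalize |u - c| / 2 = ρ at *
  have hx := abs_nonneg (v - c)
  have hy := abs_nonneg (u - v)
  generalize |v - c| = x at *
  generalize |u - v| = y at *
  have hρ' := (Real.rpow_pos_of_pos hρ (-a - b)).le
  have hP := rpowProfile_nonneg (-a) (-a - b) (x / ρ)
  have hQ := rpowProfile_nonneg (-b) (-a - b) (y / ρ)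
  rcases hx.eq_or_lt with rfl | hx
  · rw [Real.zero_rpow (neg_ne_zero.2 ha.ne'), zero_mul]
    positivity
  rcases hy.eq_or_lt with rfl | hy
  · rw [Real.zero_rpow (neg_ne_zero.2 hb.ne'), mul_zero]
    positivity
  rcases le_total x y with hxy | hxy
  · refine (rpow_neg_mul_rpow_neg_le hb.le hρ hx hxy htri).trans ?_
    gcongr
    linarith
  · rw [mul_comm]
    refine (rpow_neg_mul_rpow_neg_le ha.le hρ hy hxy (by linarith)).trans ?_
    rw [show -b - a = -a - b by ring]
    gcongr
    linarith

/-- The convolution of `|·| ^ (-a)` and `|·| ^ (-b)` is at most a multiple of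
`|·| ^ (1 - a - b)`. -/
lemma exists_lintegral_abs_rpow_neg_mul_le {a b : ℝ} (ha : 0 < a) (ha' : a < 1) (hb : 0 < b)
    (hb' : b < 1) (hab : 1 < a + b) :
    ∃ C : ℝ, 0 ≤ C ∧ ∀ c u : ℝ, u ≠ c →
      ∫⁻ v, ENNReal.ofReal (|v - c| ^ (-a) * |u - v| ^ (-b)) ≤
        ENNReal.ofReal (C * |u - c| ^ (1 - a - b)) := by
  have hI := lintegral_rpowProfile_ne_top (p := -a) (q := -a - b) (by linarith) (by linarith)
  have hJ := lintegral_rpowProfile_ne_top (p := -b) (q := -a - b) (by linarith) (by linarith)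
  have hI' := fun c ρ => lintegral_rpowProfile_abs_sub_div_le (-a) (-a - b) c (ρ := ρ)
  have hJ' := fun c ρ => lintegral_rpowProfile_abs_sub_div_le (-b) (-a - b) c (ρ := ρ)
  lift ∫⁻ x, ENNReal.ofReal (rpowProfile (-a) (-a - b) x) to NNReal using hI with I
  lift ∫⁻ x, ENNReal.ofReal (rpowProfile (-b) (-a - b) x) to NNReal using hJ with J
  refine ⟨(1 / 2) ^ (1 - a - b) * (2 * (I + J)), by positivity, fun c u hu => ?_⟩
  have hd : 0 < |u - c| := abs_pos.2 (sub_ne_zero.2 hu)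
  have hρ : 0 < |u - c| / 2 := by positivity
  calc
    _ ≤ ∫⁻ v, ENNReal.ofReal ((|u - c| / 2) ^ (-a - b)) *
          (ENNReal.ofReal (rpowProfile (-a) (-a - b) (|v - c| / (|u - c| / 2))) +
            ENNReal.ofReal (rpowProfile (-b) (-a - b) (|v - u| / (|u - c| / 2)))) := by
        refine lintegral_mono fun v => ?_
        rw [← ENNReal.ofReal_add (rpowProfile_nonneg _ _ _) (rpowProfile_nonneg _ _ _),
          ← ENNReal.ofReal_mul (by positivity)]
        exact ENNReal.ofReal_le_ofReal (abs_rpow_neg_mul_abs_rpow_neg_le ha hb hu)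
    _ ≤ ENNReal.ofReal ((|u - c| / 2) ^ (-a - b)) *
          (ENNReal.ofReal (|u - c| / 2) * (2 * I) + ENNReal.ofReal (|u - c| / 2) * (2 * J)) := by
        rw [lintegral_const_mul _ (by fun_prop), lintegral_add_left (by fun_prop)]
        gcongr
        · exact hI' c _ hρ
        · exact hJ' u _ hρ
    _ = ENNReal.ofReal ((|u - c| / 2) ^ (-a - b) * ((|u - c| / 2) * (2 * (I + J)))) := by
        rw [← mul_add, ← mul_add, ENNReal.ofReal_mul (by positivity),
          ENNReal.ofReal_mul (by positivity), ENNReal.ofReal_mul (by positivity),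
          ENNReal.ofReal_add (by positivity) (by positivity), ENNReal.ofReal_coe_nnreal,
          ENNReal.ofReal_coe_nnreal, ENNReal.ofReal_ofNat]
    _ = _ := by
        congr 1
        rw [← mul_assoc, ← Real.rpow_add_one hρ.ne', show -a - b + 1 = 1 - a - b by ring,
          div_eq_mul_one_div, Real.mul_rpow hd.le (by norm_num)]
        ring

lemma add_rpow_div_add_rpow_le {x y γ : ℝ} (hx : 0 < x) (hy : 0 < y) (hγ : 0 < γ) :
    (x ^ (-(γ / 2)) + y ^ (-(γ / 2))) / (x ^ (-(1 - γ / 2)) + y ^ (-(1 - γ / 2))) ≤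
      2 * min x y ^ (1 - γ) := by
  wlog hxy : x ≤ y generalizing x y
  · have := this hy hx (le_of_not_ge hxy)
    rwa [add_comm (y ^ _), add_comm (y ^ (-(1 - γ / 2))), min_comm] at this
  rw [min_eq_left hxy, div_le_iff₀ (by positivity)]
  have h₁ : y ^ (-(γ / 2)) ≤ x ^ (-(γ / 2)) :=
    Real.rpow_le_rpow_of_nonpos hx hxy (by linarith)
  have h₂ : x ^ (-(γ / 2)) = x ^ (1 - γ) * x ^ (-(1 - γ / 2)) := by
    rw [← Real.rpow_add hx]
    ring_nf
  have h₃ : 0 ≤ x ^ (1 - γ) * y ^ (-(1 - γ / 2)) := by positivity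
  nlinarith

lemma mul_le_sq_div_mul_add {x y a b : ℝ} (ha : 0 < a) (hb : 0 < b) :
    x * y ≤ x ^ 2 / a * b + y ^ 2 / b * a := by
  have h : (x * y) ^ 2 ≤ (x ^ 2 / a * b + y ^ 2 / b * a) ^ 2 := by
    have h₁ : (x * y) ^ 2 = (x ^ 2 / a * b) * (y ^ 2 / b * a) := by field_simp
    have h₂ : 0 ≤ x ^ 2 / a * b := by positivity
    have h₃ : 0 ≤ y ^ 2 / b * a := by positivity
    nlinarith
  exact le_of_sq_le_sq h (by positivity)

/-- A weighted Stein–Weiss inequality on the line, with weight singular at `0` and `s`. -/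
lemma exists_lintegral_lintegral_mul_abs_sub_rpow_le {γ : ℝ} (hγ : 0 < γ) (hγ' : γ < 1) :
    ∃ C : ℝ, 0 ≤ C ∧ ∀ s : ℝ, 0 < s → ∀ f : ℝ → ℝ, Measurable f →
      ∫⁻ u, ∫⁻ v, ENNReal.ofReal (f u * f v * |u - v| ^ (-γ)) ≤
        ENNReal.ofReal C *
          ∫⁻ u, ENNReal.ofReal (f u ^ 2 * min |u| |u - s| ^ (1 - γ)) := by
  obtain ⟨C, hC, hconv⟩ := exists_lintegral_abs_rpow_neg_mul_le (a := 1 - γ / 2) (b := γ)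
    (by linarith) (by linarith) hγ hγ' (by linarith)
  have hexp : 1 - (1 - γ / 2) - γ = -(γ / 2) := by ring
  rw [hexp] at hconv
  refine ⟨4 * C, by positivity, fun s hs f hf => ?_⟩
  obtain ⟨W, hW⟩ : ∃ W : ℝ → ℝ, ∀ v, W v = |v| ^ (-(1 - γ / 2)) + |v - s| ^ (-(1 - γ / 2)) :=
    ⟨_, fun _ => rfl⟩
  have hWm : Measurable W := by
    rw [funext hW]
    fun_prop
  have hW0 : ∀ v, 0 < W v := by
    intro v
    rcases eq_or_ne v 0 with rfl | hv
    · have : 0 < |0 - s| := abs_pos.2 (by linarith)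
      have := Real.rpow_pos_of_pos this (-(1 - γ / 2))
      have := Real.rpow_nonneg (abs_nonneg (0 : ℝ)) (-(1 - γ / 2))
      simp only [hW]
      linarith
    · have : 0 < |v| := abs_pos.2 hv
      simp only [hW]
      positivity
  obtain ⟨T, hT⟩ : ∃ T : ℝ → ℝ → ENNReal, ∀ u v,
      T u v = ENNReal.ofReal (f u ^ 2 / W u * (W v * |u - v| ^ (-γ))) := ⟨_, fun _ _ => rfl⟩
  have hTm : Measurable (Function.uncurry T) := by
    simp only [hT, Function.uncurry_def]
    fun_prop
  have hTm' : Measurable (Function.uncurry fun u v => T v u) := hTm.comp measurable_swap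
  have hinner : ∀ᵐ u : ℝ, ∫⁻ v, T u v ≤
      ENNReal.ofReal (2 * C) * ENNReal.ofReal (f u ^ 2 * min |u| |u - s| ^ (1 - γ)) := by
    filter_upwards [Measure.ae_ne volume (0 : ℝ), Measure.ae_ne volume s] with u hu0 hus
    have h0 : 0 < |u| := abs_pos.2 hu0
    have h1 : 0 < |u - s| := abs_pos.2 (sub_ne_zero.2 hus)
    have hfW : 0 ≤ f u ^ 2 / W u := div_nonneg (sq_nonneg _) (hW0 u).le
    have hI₀ := hconv 0 u hu0
    have hI₁ := hconv s u hus
    simp only [sub_zero] at hI₀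
    calc
      ∫⁻ v, T u v = ENNReal.ofReal (f u ^ 2 / W u) *
            ((∫⁻ v, ENNReal.ofReal (|v| ^ (-(1 - γ / 2)) * |u - v| ^ (-γ))) +
              ∫⁻ v, ENNReal.ofReal (|v - s| ^ (-(1 - γ / 2)) * |u - v| ^ (-γ))) := by
          rw [← lintegral_add_left (by fun_prop), ← lintegral_const_mul _ (by fun_prop)]
          refine lintegral_congr fun v => ?_
          rw [← ENNReal.ofReal_add (by positivity) (by positivity), ← ENNReal.ofReal_mul hfW,
            ← add_mul, hT, hW v]
      _ ≤ ENNReal.ofReal (f u ^ 2 / W u) * (ENNReal.ofReal (C * |u| ^ (-(γ / 2))) +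
            ENNReal.ofReal (C * |u - s| ^ (-(γ / 2)))) := by gcongr
      _ = ENNReal.ofReal (C * f u ^ 2 *
            ((|u| ^ (-(γ / 2)) + |u - s| ^ (-(γ / 2))) / W u)) := by
          rw [← ENNReal.ofReal_add (by positivity) (by positivity), ← ENNReal.ofReal_mul hfW]
          congr 1
          ring
      _ ≤ ENNReal.ofReal (C * f u ^ 2 * (2 * min |u| |u - s| ^ (1 - γ))) := by
          rw [hW]
          gcongr
          exact add_rpow_div_add_rpow_le h0 h1 hγ
      _ = _ := by
          rw [← ENNReal.ofReal_mul (by positivity)]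
          congr 1
          ring
  calc
    _ ≤ ∫⁻ u, ∫⁻ v, (T u v + T v u) := by
        refine lintegral_mono fun u => lintegral_mono fun v => ?_
        have hu := hW0 u
        have hv := hW0 v
        simp only [hT]
        rw [abs_sub_comm v u, ← ENNReal.ofReal_add (by positivity) (by positivity)]
        refine ENNReal.ofReal_le_ofReal ?_
        have := mul_le_mul_of_nonneg_right (mul_le_sq_div_mul_add (x := f u) (y := f v) hu hv)
          (Real.rpow_nonneg (abs_nonneg (u - v)) (-γ))
        linarith
    _ = 2 * ∫⁻ u, ∫⁻ v, T u v := by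
        have h : ∀ u, ∫⁻ v, (T u v + T v u) = (∫⁻ v, T u v) + ∫⁻ v, T v u := fun u =>
          lintegral_add_left (hTm.comp measurable_prodMk_left) _
        simp_rw [h]
        have hm : Measurable fun u => ∫⁻ v, T u v := hTm.lintegral_prod_right'
        rw [lintegral_add_left hm,
          lintegral_lintegral_swap hTm'.aemeasurable, two_mul]
    _ ≤ 2 * ∫⁻ u, ENNReal.ofReal (2 * C) *
          ENNReal.ofReal (f u ^ 2 * min |u| |u - s| ^ (1 - γ)) := by
        gcongr 2 * ?_
        exact lintegral_mono_ae hinner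
    _ = _ := by
        rw [lintegral_const_mul _ (by fun_prop), ← mul_assoc,
          ← ENNReal.ofReal_ofNat 2, ← ENNReal.ofReal_mul (by norm_num)]
        congr 2
        ring

@[fun_prop]
lemma measurable_fracKernel (β s : ℝ) : Measurable (fracKernel β s) := by
  unfold fracKernel
  split_ifs
  · exact measurable_const.indicator measurableSet_Ioc
  · fun_prop

lemma abs_fracKernel_le_of_mem_Ioo {β s u : ℝ} (hu : u ∈ Set.Ioo 0 s) :
    |fracKernel β s u| ≤ (1 + |β|⁻¹) * (s - u) ^ β := by
  obtain ⟨h0, hs⟩ := hu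
  rcases eq_or_ne β 0 with rfl | hβ
  · simp [fracKernel, h0, hs.le]
  · have hsu : 0 < s - u := sub_pos.2 hs
    rw [fracKernel, if_neg hβ, max_eq_left hsu.le, max_eq_right (by linarith),
      Real.zero_rpow hβ, sub_zero, abs_mul, one_div, abs_inv,
      abs_of_pos (Real.rpow_pos_of_pos hsu β)]
    gcongr
    linarith

lemma fracKernel_of_lt {β s u : ℝ} (hs : 0 < s) (hu : s < u) : fracKernel β s u = 0 := by
  unfold fracKernel
  split_ifs with hβ
  · simp [hu]
  · rw [max_eq_right (by linarith), max_eq_right (by linarith)]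
    simp

lemma abs_fracKernel_neg_le_of_pos {β s y : ℝ} (hs : 0 < s) (hy : 0 < y) (hβ : β ≤ 1) :
    |fracKernel β s (-y)| ≤ (1 + |β|⁻¹) * (s ^ β * (y / s) ^ min β 0) := by
  have hys : 0 < y / s := div_pos hy hs
  rcases eq_or_ne β 0 with rfl | hβ0
  · simp [fracKernel, hy.not_gt]
  · have h : |(s + y) ^ β - y ^ β| ≤ s ^ β * (y / s) ^ min β 0 := by
      rcases lt_or_gt_of_ne hβ0 with hneg | hpos
      · have h₁ : (s + y) ^ β ≤ y ^ β := Real.rpow_le_rpow_of_nonpos hy (by linarith) hneg.le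
        have h₂ : 0 < (s + y) ^ β := by positivity
        rw [min_eq_left hneg.le, Real.div_rpow hy.le hs.le,
          mul_div_cancel₀ _ (Real.rpow_pos_of_pos hs β).ne', abs_of_nonpos (by linarith)]
        linarith
      · have h₁ : y ^ β ≤ (s + y) ^ β := Real.rpow_le_rpow hy.le (by linarith) hpos.le
        have h₂ := Real.rpow_add_le_add_rpow hs.le hy.le hpos.le hβ
        rw [min_eq_right hpos.le, Real.rpow_zero, mul_one, abs_of_nonneg (by linarith)]
        linarith
    rw [fracKernel, if_neg hβ0, sub_neg_eq_add, neg_neg, max_eq_left (by positivity),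
      max_eq_left hy.le, abs_mul, one_div, abs_inv]
    gcongr
    linarith

lemma abs_fracKernel_neg_le_mul_rpow {β s y : ℝ} (hs : 0 < s) (hy : 0 < y) (hβ : β ≤ 1) :
    |fracKernel β s (-y)| ≤ (1 + |β|⁻¹) * (s ^ β * (y / s) ^ (β - 1)) := by
  have hys : 0 < y / s := div_pos hy hs
  rcases eq_or_ne β 0 with rfl | hβ0
  · simp only [fracKernel, if_true, Set.indicator_apply, Set.mem_Ioc]
    rw [if_neg (by intro h; linarith [h.1]), abs_zero]
    positivity
  · have hmvt : ‖(s + y) ^ β - y ^ β‖ ≤ |β| * y ^ (β - 1) * ‖(s + y) - y‖ := by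
      refine Convex.norm_image_sub_le_of_norm_deriv_le (𝕜 := ℝ) (f := fun x : ℝ => x ^ β)
        (s := Set.Ici y) ?_ ?_ (convex_Ici y) Set.self_mem_Ici
        (by simp only [Set.mem_Ici]; linarith)
      · intro x hx
        exact Real.differentiableAt_rpow_const_of_ne _ (hy.trans_le hx).ne'
      · intro x hx
        rw [Real.deriv_rpow_const, norm_mul, Real.norm_eq_abs, Real.norm_eq_abs,
          abs_of_pos (Real.rpow_pos_of_pos (hy.trans_le hx) _)]
        exact mul_le_mul_of_nonneg_left
          (Real.rpow_le_rpow_of_nonpos hy hx (by linarith)) (abs_nonneg β)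
    rw [add_sub_cancel_right, Real.norm_eq_abs, Real.norm_eq_abs, abs_of_pos hs] at hmvt
    have hpow : s ^ β * (y / s) ^ (β - 1) = y ^ (β - 1) * s := by
      rw [Real.div_rpow hy.le hs.le, Real.rpow_sub_one hs.ne']
      have := Real.rpow_pos_of_pos hs β
      field_simp
    have hβpos : 0 < |β| := abs_pos.2 hβ0
    rw [fracKernel, if_neg hβ0, sub_neg_eq_add, neg_neg, max_eq_left (by positivity),
      max_eq_left hy.le, abs_mul, one_div, abs_inv, hpow]
    calc
      _ ≤ |β|⁻¹ * (|β| * y ^ (β - 1) * s) := by gcongr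
      _ = 1 * (y ^ (β - 1) * s) := by field_simp
      _ ≤ _ := by
        gcongr
        linarith [inv_pos.2 hβpos]

lemma sq_mul_rpow_le_of_abs_le {A β δ e k m s x : ℝ} (hs : 0 < s) (hx : 0 < x)
    (hδ : 0 ≤ δ) (hk : |k| ≤ A * (s ^ β * (x / s) ^ e)) (hm : 0 ≤ m) (hmx : m ≤ x) :
    k ^ 2 * m ^ δ ≤ A ^ 2 * s ^ (2 * β + δ) * (x / s) ^ (2 * e + δ) := by
  have hxs : 0 < x / s := div_pos hx hs
  calc
    k ^ 2 * m ^ δ = |k| ^ 2 * m ^ δ := by rw [sq_abs]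
    _ ≤ (A * (s ^ β * (x / s) ^ e)) ^ 2 * x ^ δ := by gcongr
    _ = (A * (s ^ β * (x / s) ^ e)) ^ 2 * (s * (x / s)) ^ δ := by
        rw [mul_div_cancel₀ _ hs.ne']
    _ = _ := by
        rw [Real.mul_rpow hs.le hxs.le, Real.rpow_add hs, Real.rpow_add hxs,
          mul_comm 2 β, mul_comm 2 e, Real.rpow_mul hs.le, Real.rpow_mul hxs.le,
          Real.rpow_two, Real.rpow_two]
        ring

lemma fracKernel_sq_mul_min_rpow_le {β δ s u : ℝ} (hs : 0 < s) (hβ : β ≤ 1) (hδ : 0 ≤ δ)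
    (hu0 : u ≠ 0) (hus : u ≠ s) :
    fracKernel β s u ^ 2 * min |u| |u - s| ^ δ ≤ (1 + |β|⁻¹) ^ 2 * s ^ (2 * β + δ) *
      (rpowProfile (2 * β + δ) (2 * (β - 1) + δ) ((s - u) / s) +
        rpowProfile (2 * min β 0 + δ) (2 * (β - 1) + δ) (-u / s)) := by
  have hP := rpowProfile_nonneg (2 * β + δ) (2 * (β - 1) + δ) ((s - u) / s)
  have hQ := rpowProfile_nonneg (2 * min β 0 + δ) (2 * (β - 1) + δ) (-u / s)
  have hm : 0 ≤ min |u| |u - s| := by positivity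
  rcases lt_or_gt_of_ne hus with hlt | hgt
  · rcases lt_or_gt_of_ne hu0 with hneg | hpos
    · obtain ⟨y, rfl⟩ : ∃ y, u = -y := ⟨-u, by simp⟩
      have hy : 0 < y := by linarith
      have hmy : min |-y| |-y - s| ≤ y := (min_le_left _ _).trans (by rw [abs_neg, abs_of_pos hy])
      rw [neg_neg] at hQ ⊢
      suffices h : fracKernel β s (-y) ^ 2 * min |-y| |-y - s| ^ δ ≤
          (1 + |β|⁻¹) ^ 2 * s ^ (2 * β + δ) *
            rpowProfile (2 * min β 0 + δ) (2 * (β - 1) + δ) (y / s) by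
        refine h.trans ?_
        gcongr
        linarith
      rcases le_or_gt y s with hys | hys
      · rw [rpowProfile_of_le_one (div_pos hy hs) ((div_le_one hs).2 hys)]
        exact sq_mul_rpow_le_of_abs_le hs hy hδ (abs_fracKernel_neg_le_of_pos hs hy hβ) hm hmy
      · rw [rpowProfile_of_one_lt ((one_lt_div hs).2 hys)]
        exact sq_mul_rpow_le_of_abs_le hs hy hδ (abs_fracKernel_neg_le_mul_rpow hs hy hβ) hm hmy
    · have hx : 0 < s - u := sub_pos.2 hlt
      have hmx : min |u| |u - s| ≤ s - u :=
        (min_le_right _ _).trans (by rw [abs_sub_comm, abs_of_pos hx])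
      have hk := abs_fracKernel_le_of_mem_Ioo (β := β) ⟨hpos, hlt⟩
      have hpow : (s - u) ^ β = s ^ β * ((s - u) / s) ^ β := by
        rw [Real.div_rpow hx.le hs.le, mul_div_cancel₀ _ (Real.rpow_pos_of_pos hs β).ne']
      rw [hpow] at hk
      have h := sq_mul_rpow_le_of_abs_le hs hx hδ hk hm hmx
      rw [← rpowProfile_of_le_one (q := 2 * (β - 1) + δ) (div_pos hx hs)
        ((div_le_one hs).2 (by linarith))] at h
      refine h.trans ?_
      gcongr
      linarith
  · rw [fracKernel_of_lt hs hgt]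
    have : 0 ≤ s ^ (2 * β + δ) := by positivity
    simp only [ne_eq, OfNat.ofNat_ne_zero, not_false_eq_true, zero_pow, zero_mul]
    positivity

lemma exists_lintegral_fracKernel_sq_mul_le {β δ : ℝ} (hβ : β ≤ 1) (hδ : 0 ≤ δ)
    (h₀ : -1 < 2 * β + δ) (h₁ : 2 * (β - 1) + δ < -1) :
    ∃ C : ℝ, 0 ≤ C ∧ ∀ s : ℝ, 0 < s →
      ∫⁻ u, ENNReal.ofReal (fracKernel β s u ^ 2 * min |u| |u - s| ^ δ) ≤
        ENNReal.ofReal (C * s ^ (2 * β + δ + 1)) := by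
  have hmin : -1 < 2 * min β 0 + δ := by
    rcases min_cases β 0 with ⟨h, -⟩ | ⟨h, -⟩ <;> rw [h] <;> linarith
  have hI := lintegral_rpowProfile_ne_top h₀ h₁
  have hJ := lintegral_rpowProfile_ne_top hmin h₁
  have hI' := fun s hs => lintegral_comp_div_right (ρ := s)
    (f := fun x => ENNReal.ofReal (rpowProfile (2 * β + δ) (2 * (β - 1) + δ) x)) (by fun_prop) hs
  have hJ' := fun s hs => lintegral_comp_div_right (ρ := s)
    (f := fun x => ENNReal.ofReal (rpowProfile (2 * min β 0 + δ) (2 * (β - 1) + δ) x))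
    (by fun_prop) hs
  lift ∫⁻ x, ENNReal.ofReal (rpowProfile (2 * β + δ) (2 * (β - 1) + δ) x) to NNReal
    using hI with I
  lift ∫⁻ x, ENNReal.ofReal (rpowProfile (2 * min β 0 + δ) (2 * (β - 1) + δ) x) to NNReal
    using hJ with J
  refine ⟨(1 + |β|⁻¹) ^ 2 * (I + J), by positivity, fun s hs => ?_⟩
  calc
    _ ≤ ∫⁻ u, ENNReal.ofReal ((1 + |β|⁻¹) ^ 2 * s ^ (2 * β + δ)) *
          (ENNReal.ofReal (rpowProfile (2 * β + δ) (2 * (β - 1) + δ) ((s - u) / s)) +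
            ENNReal.ofReal (rpowProfile (2 * min β 0 + δ) (2 * (β - 1) + δ) (-u / s))) := by
        refine lintegral_mono_ae ?_
        filter_upwards [Measure.ae_ne volume (0 : ℝ), Measure.ae_ne volume s] with u hu0 hus
        rw [← ENNReal.ofReal_add (rpowProfile_nonneg _ _ _) (rpowProfile_nonneg _ _ _),
          ← ENNReal.ofReal_mul (by positivity)]
        exact ENNReal.ofReal_le_ofReal (fracKernel_sq_mul_min_rpow_le hs hβ hδ hu0 hus)
    _ = ENNReal.ofReal ((1 + |β|⁻¹) ^ 2 * s ^ (2 * β + δ)) *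
          (ENNReal.ofReal s * I + ENNReal.ofReal s * J) := by
        rw [lintegral_const_mul _ (by fun_prop), lintegral_add_left (by fun_prop),
          lintegral_sub_left_eq_self (fun x => ENNReal.ofReal
            (rpowProfile (2 * β + δ) (2 * (β - 1) + δ) (x / s))) s,
          lintegral_neg_eq_self (fun x => ENNReal.ofReal
            (rpowProfile (2 * min β 0 + δ) (2 * (β - 1) + δ) (x / s))), hI' s hs, hJ' s hs]
    _ = ENNReal.ofReal ((1 + |β|⁻¹) ^ 2 * s ^ (2 * β + δ) * (s * (I + J))) := by
        rw [← mul_add, ENNReal.ofReal_mul (p := (1 + |β|⁻¹) ^ 2 * s ^ (2 * β + δ)) (by positivity),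
          ENNReal.ofReal_mul hs.le, ENNReal.ofReal_add (by positivity) (by positivity),
          ENNReal.ofReal_coe_nnreal, ENNReal.ofReal_coe_nnreal]
    _ = _ := by
        rw [Real.rpow_add_one hs.ne']
        ring_nf

lemma abs_pow_le_of_abs_le_mul_rpow {K : ℝ → ℝ} {κ β : ℝ} (n : ℕ)
    (hK : ∀ u : ℝ, 0 < u → |K u| ≤ κ * u ^ (β - 1)) {x : ℝ} (hx : 0 < x) :
    |K x| ^ n ≤ κ ^ n * x ^ (-(n * (1 - β))) := by
  calc
    |K x| ^ n ≤ (κ * x ^ (β - 1)) ^ n := by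
      gcongr
      exact hK x hx
    _ = _ := by
      rw [mul_pow, ← Real.rpow_natCast (x ^ (β - 1)), ← Real.rpow_mul hx.le]
      ring_nf

/-- If `|K(u)| ≤ κ u^{β₂−1}` for `u > 0`, then
`∫∫ |k_s^{β₁}(u)| |k_s^{β₁}(v)| |K(|u−v|)|^n du dv ≤ C κ^n s^{2α}` (the double integral
being in particular finite), where `α = β₁ + (n/2)(β₂−1) + 1 ∈ (0,1)` and `C` depends
only on `n`, `β₁` and `β₂`. -/
theorem double_integral_fracKernel_bound
    (n : ℕ) (hn : 1 ≤ n) (β₁ β₂ : ℝ)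
    (hβ₂ : 1 - 1 / (n : ℝ) < β₂ ∧ β₂ < 1)
    (α : ℝ) (hα : α = β₁ + ((n : ℝ) / 2) * (β₂ - 1) + 1) (hα0 : 0 < α) (hα1 : α < 1) :
    ∃ C : ℝ, 0 < C ∧ ∀ κ : ℝ, 0 < κ → ∀ K : ℝ → ℝ, Measurable K →
      (∀ u : ℝ, 0 < u → |K u| ≤ κ * u ^ (β₂ - 1)) →
      ∀ s : ℝ, 0 < s →
        (∫⁻ u : ℝ, ∫⁻ v : ℝ, ENNReal.ofReal
            (|fracKernel β₁ s u| * |fracKernel β₁ s v| * |K (|u - v|)| ^ n)) ≤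
          ENNReal.ofReal (C * κ ^ n * s ^ (2 * α)) := by
  have hn0 : (0 : ℝ) < n := by exact_mod_cast hn
  obtain ⟨γ, hγ⟩ : ∃ γ : ℝ, γ = n * (1 - β₂) := ⟨_, rfl⟩
  have hγ0 : 0 < γ := hγ ▸ mul_pos hn0 (by linarith [hβ₂.2])
  have hγ1 : γ < 1 := by
    have h : 1 - β₂ < 1 / n := by linarith [hβ₂.1]
    rw [lt_div_iff₀ hn0] at h
    linarith
  have hαγ : α = β₁ - γ / 2 + 1 := by rw [hα, hγ]; ring
  obtain ⟨C₁, hC₁, hform⟩ := exists_lintegral_lintegral_mul_abs_sub_rpow_le hγ0 hγ1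
  obtain ⟨C₂, hC₂, hker⟩ := exists_lintegral_fracKernel_sq_mul_le (β := β₁) (δ := 1 - γ)
    (by linarith) (by linarith) (by linarith) (by linarith)
  refine ⟨C₁ * C₂ + 1, by positivity, fun κ hκ K _ hK s hs => ?_⟩
  have hexp : 2 * β₁ + (1 - γ) + 1 = 2 * α := by rw [hαγ]; ring
  have hform' := hform s hs (fun u => |fracKernel β₁ s u|) (by fun_prop)
  simp only [sq_abs] at hform'
  calc
    _ ≤ ∫⁻ u, ∫⁻ v, ENNReal.ofReal (κ ^ n) * ENNReal.ofReal
          (|fracKernel β₁ s u| * |fracKernel β₁ s v| * |u - v| ^ (-γ)) := by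
        refine lintegral_mono fun u => lintegral_mono_ae ?_
        filter_upwards [Measure.ae_ne volume u] with v hv
        rw [← ENNReal.ofReal_mul (by positivity)]
        refine ENNReal.ofReal_le_ofReal ?_
        have h := abs_pow_le_of_abs_le_mul_rpow n hK (abs_pos.2 (sub_ne_zero.2 hv.symm))
        rw [← hγ] at h
        calc
          _ ≤ |fracKernel β₁ s u| * |fracKernel β₁ s v| * (κ ^ n * |u - v| ^ (-γ)) := by gcongr
          _ = _ := by ring
    _ = ENNReal.ofReal (κ ^ n) * ∫⁻ u, ∫⁻ v, ENNReal.ofReal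
          (|fracKernel β₁ s u| * |fracKernel β₁ s v| * |u - v| ^ (-γ)) := by
        simp_rw [lintegral_const_mul' _ _ ENNReal.ofReal_ne_top]
    _ ≤ ENNReal.ofReal (κ ^ n) *
          (ENNReal.ofReal C₁ * ENNReal.ofReal (C₂ * s ^ (2 * α))) := by
        gcongr
        refine hform'.trans ?_
        gcongr
        exact hexp ▸ hker s hs
    _ = ENNReal.ofReal (C₁ * C₂ * κ ^ n * s ^ (2 * α)) := by
        rw [← ENNReal.ofReal_mul hC₁, ← ENNReal.ofReal_mul (by positivity)]
        ring_nf
    _ ≤ _ := by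
        gcongr
        linarith
end

section
/- Let n ≥ 1 be an integer, β₁ ∈ ℝ, β₂ ∈ (1 − 1/n, 1), T > 0, and suppose α := β₁ + (n/2)(β₂ − 1) + 1 satisfies 0 < α < 1. Then there is a constant C, depending only on n, β₁, β₂ and T, such that for all s, t ∈ (0, T]: Q(s, t) := ∫_{ℝ} ∫_{ℝ} |k_t^{β₁}(u)| |k_s^{β₁}(v)| · |u − v|^{0, n(β₂−1)} dv du ≤ C · s^{1 + min(β₁, 0)} · t^{1 + min(β₁, 0)}. -/
open MeasureTheory

/-- The truncated power `|x|^{γ₁,γ₂}`, equal to `|x|^{γ₁}` if `|x| < 1` and `|x|^{γ₂}`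
if `|x| ≥ 1` (with the convention `|x|^0 = 1` for all `x`, valid for `Real.rpow`). -/
noncomputable def truncPow (γ₁ γ₂ x : ℝ) : ℝ := if |x| < 1 then |x| ^ γ₁ else |x| ^ γ₂

/-- The power `x ^ p` on `(0, c]`, extended by zero. -/
noncomputable def powNear (p c x : ℝ) : ENNReal :=
  Set.indicator (Set.Ioc 0 c) (fun y => ENNReal.ofReal (y ^ p)) x

/-- The power `x ^ p` on `(c, ∞)`, extended by zero. -/
noncomputable def powFar (p c x : ℝ) : ENNReal :=
  Set.indicator (Set.Ioi c) (fun y => ENNReal.ofReal (y ^ p)) x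

@[fun_prop]
lemma measurable_powNear (p c : ℝ) : Measurable (powNear p c) :=
  Measurable.indicator (by fun_prop) measurableSet_Ioc

@[fun_prop]
lemma measurable_powFar (p c : ℝ) : Measurable (powFar p c) :=
  Measurable.indicator (by fun_prop) measurableSet_Ioi

lemma lintegral_powNear {p c : ℝ} (hp : -1 < p) (hc : 0 ≤ c) :
    ∫⁻ x, powNear p c x = ENNReal.ofReal (c ^ (p + 1) / (p + 1)) := by
  unfold powNear
  rw [lintegral_indicator measurableSet_Ioc, ← ofReal_integral_eq_lintegral_ofReal,
    ← intervalIntegral.integral_of_le hc, integral_rpow (Or.inl hp),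
    Real.zero_rpow (by linarith), sub_zero]
  · exact (intervalIntegral.intervalIntegrable_rpow' hp).1
  · filter_upwards [ae_restrict_mem measurableSet_Ioc] with x hx
    exact Real.rpow_nonneg hx.1.le _

lemma lintegral_powFar {p c : ℝ} (hp : p < -1) (hc : 0 < c) :
    ∫⁻ x, powFar p c x = ENNReal.ofReal (-c ^ (p + 1) / (p + 1)) := by
  unfold powFar
  rw [lintegral_indicator measurableSet_Ioi, ← ofReal_integral_eq_lintegral_ofReal,
    integral_Ioi_rpow_of_lt hp hc]
  · exact integrableOn_Ioi_rpow_of_lt hp hc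
  · filter_upwards [ae_restrict_mem measurableSet_Ioi] with x hx
    exact Real.rpow_nonneg (hc.trans hx).le _

lemma abs_add_rpow_sub_rpow_le {β x t : ℝ} (hβ : β ≤ 1) (hx : 0 < x) (ht : 0 ≤ t) :
    |(x + t) ^ β - x ^ β| ≤ |β| * x ^ (β - 1) * t := by
  have h := Convex.norm_image_sub_le_of_norm_hasDerivWithin_le (𝕜 := ℝ) (G := ℝ)
    (f := fun y => y ^ β) (f' := fun y => β * y ^ (β - 1)) (s := Set.Icc x (x + t))
    (x := x) (y := x + t) (C := |β| * x ^ (β - 1))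
    (fun y hy => (Real.hasDerivAt_rpow_const
      (Or.inl (hx.trans_le hy.1).ne')).hasDerivWithinAt)
    (fun y hy => by
      rw [norm_mul, Real.norm_eq_abs, Real.norm_eq_abs,
        abs_of_nonneg (Real.rpow_nonneg (hx.trans_le hy.1).le _)]
      exact mul_le_mul_of_nonneg_left
        (Real.rpow_le_rpow_of_nonpos hx hy.1 (by linarith)) (abs_nonneg _))
    (convex_Icc _ _) ⟨le_rfl, by linarith⟩ ⟨by linarith, le_rfl⟩
  simpa [Real.norm_eq_abs, abs_of_nonneg ht] using h

lemma abs_fracKernel_of_neg_le {β t u : ℝ} (h0 : β ≠ 0) (hβ : β ≤ 1) (ht : 0 ≤ t)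
    (hu : u < 0) : |fracKernel β t u| ≤ t * (-u) ^ (β - 1) := by
  have h := abs_add_rpow_sub_rpow_le hβ (neg_pos.2 hu) ht
  have e : max (t - u) 0 = -u + t := by rw [max_eq_left] <;> linarith
  rw [fracKernel, if_neg h0, e, max_eq_left (by linarith : (0 : ℝ) ≤ -u), abs_mul, abs_div,
    abs_one, one_div, inv_mul_le_iff₀ (abs_pos.2 h0)]
  linarith

lemma abs_fracKernel_of_nonneg_lt {β t u : ℝ} (h0 : β ≠ 0) (hu : 0 ≤ u) (hut : u < t) :
    |fracKernel β t u| = |β|⁻¹ * (t - u) ^ β := by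
  rw [fracKernel, if_neg h0, max_eq_left (by linarith), max_eq_right (by linarith),
    Real.zero_rpow h0, sub_zero, abs_mul, abs_div, abs_one, one_div,
    abs_of_nonneg (Real.rpow_nonneg (by linarith) _)]

lemma fracKernel_of_nonneg_le {β t u : ℝ} (h0 : β ≠ 0) (hu : 0 ≤ u) (hut : t ≤ u) :
    fracKernel β t u = 0 := by
  rw [fracKernel, if_neg h0, max_eq_right (by linarith), max_eq_right (by linarith), sub_self,
    mul_zero]

lemma abs_fracKernel_of_neg_exponent_le {β t u : ℝ} (hβ : β < 0) (ht : 0 ≤ t) (hu : u < 0) :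
    |fracKernel β t u| ≤ |β|⁻¹ * (-u) ^ β := by
  have h1 := Real.rpow_le_rpow_of_nonpos (neg_pos.2 hu) (by linarith : -u ≤ t - u) hβ.le
  have h2 : 0 ≤ (t - u) ^ β := Real.rpow_nonneg (by linarith) _
  rw [fracKernel, if_neg hβ.ne, max_eq_left (by linarith), max_eq_left (by linarith), abs_mul,
    abs_div, abs_one, one_div]
  refine mul_le_mul_of_nonneg_left ?_ (by positivity)
  rw [abs_sub_comm, abs_of_nonneg (by linarith)]
  linarith

/-- `max 1 |x| ^ p`, as an extended nonnegative real. -/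
noncomputable def japanesePow (p x : ℝ) : ENNReal := ENNReal.ofReal ((max 1 |x|) ^ p)

@[fun_prop]
lemma measurable_japanesePow (p : ℝ) : Measurable (japanesePow p) := by
  unfold japanesePow; fun_prop

lemma japanesePow_neg_arg (p x : ℝ) : japanesePow p (-x) = japanesePow p x := by
  simp [japanesePow]

lemma japanesePow_sub_comm (p x y : ℝ) : japanesePow p (x - y) = japanesePow p (y - x) := by
  rw [← japanesePow_neg_arg, neg_sub]

lemma japanesePow_le_one {p : ℝ} (hp : p ≤ 0) (x : ℝ) : japanesePow p x ≤ 1 := by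
  unfold japanesePow
  rw [ENNReal.ofReal_le_one]
  exact Real.rpow_le_one_of_one_le_of_nonpos (le_max_left _ _) hp

lemma ofReal_truncPow_zero (p x : ℝ) :
    ENNReal.ofReal (truncPow 0 p x) = japanesePow p x := by
  unfold truncPow japanesePow
  split_ifs with h
  · rw [max_eq_left h.le]; simp
  · rw [max_eq_right (not_lt.1 h)]

lemma lintegral_japanesePow_lt_top {p : ℝ} (hp : p < -1) : ∫⁻ x, japanesePow p x < ⊤ := by
  have h := finite_integral_one_add_norm (E := ℝ) (μ := volume) (r := -p)
    (by simp; linarith)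
  refine lt_of_le_of_lt (lintegral_mono (g := fun x =>
    ENNReal.ofReal (2 ^ (-p)) * ENNReal.ofReal ((1 + ‖x‖) ^ (- -p))) fun x => ?_) ?_
  · simp only [japanesePow]
    rw [← ENNReal.ofReal_mul (by positivity)]
    refine ENNReal.ofReal_le_ofReal ?_
    rw [neg_neg, Real.rpow_neg two_pos.le, ← Real.inv_rpow two_pos.le,
      ← Real.mul_rpow (by positivity) (by positivity)]
    refine Real.rpow_le_rpow_of_nonpos (by positivity) ?_ (by linarith)
    rw [Real.norm_eq_abs]
    linarith [le_max_left 1 |x|, le_max_right 1 |x|]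
  · rw [lintegral_const_mul _ (by fun_prop)]
    exact ENNReal.mul_lt_top ENNReal.ofReal_lt_top h

lemma rpow_mul_rpow_le_add {a b p q : ℝ} (ha : 0 < a) (hb : 0 < b) (hp : p ≤ 0) (hq : q ≤ 0) :
    a ^ p * b ^ q ≤ a ^ (p + q) + b ^ (p + q) := by
  rw [Real.rpow_add ha, Real.rpow_add hb]
  have hap := Real.rpow_nonneg ha.le p
  have hbq := Real.rpow_nonneg hb.le q
  have haq := Real.rpow_nonneg ha.le q
  have hbp := Real.rpow_nonneg hb.le p
  rcases le_total a b with h | h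
  · have := Real.rpow_le_rpow_of_nonpos ha h hq
    nlinarith [mul_nonneg hbp hbq, mul_le_mul_of_nonneg_left this hap]
  · have := Real.rpow_le_rpow_of_nonpos hb h hp
    nlinarith [mul_nonneg hap haq, mul_le_mul_of_nonneg_right this hbq]

lemma lintegral_japanesePow_mul_le {p q : ℝ} (hp : p ≤ 0) (hq : q ≤ 0) (u : ℝ) :
    ∫⁻ v, japanesePow p v * japanesePow q (u - v) ≤ 2 * ∫⁻ x, japanesePow (p + q) x := by
  calc ∫⁻ v, japanesePow p v * japanesePow q (u - v)
      ≤ ∫⁻ v, (japanesePow (p + q) v + japanesePow (p + q) (u - v)) := by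
        refine lintegral_mono fun v => ?_
        simp only [japanesePow]
        rw [← ENNReal.ofReal_mul (by positivity), ← ENNReal.ofReal_add (by positivity)
          (by positivity)]
        exact ENNReal.ofReal_le_ofReal
          (rpow_mul_rpow_le_add (by positivity) (by positivity) hp hq)
    _ = 2 * ∫⁻ x, japanesePow (p + q) x := by
        rw [lintegral_add_left (by fun_prop),
          lintegral_sub_left_eq_self (fun x => japanesePow (p + q) x) u, two_mul]

lemma rpow_mul_rpow_mul_rpow_le {a b c p q ε : ℝ} (ha : 1 ≤ a) (hab : a ≤ b) (hc : 1 ≤ c)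
    (hcb : c ≤ 2 * b) (hq : 0 ≤ 1 + ε + q) (hpq : p + (1 + ε + q) ≤ 0)
    (he : p + (p + (1 + ε + q)) = -(1 + ε)) :
    a ^ p * b ^ p * c ^ q ≤ 2 ^ (1 + ε + q) * (a ^ (-(1 + ε)) * c ^ (-(1 + ε))) := by
  have ha0 : 0 < a := by linarith
  have hb0 : 0 < b := by linarith
  have hc0 : 0 < c := by linarith
  have h1 : c ^ q ≤ c ^ (-(1 + ε)) * (2 ^ (1 + ε + q) * b ^ (1 + ε + q)) := by
    rw [← Real.mul_rpow two_pos.le hb0.le]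
    calc c ^ q = c ^ (-(1 + ε)) * c ^ (1 + ε + q) := by
          rw [← Real.rpow_add hc0]; congr 1; ring
      _ ≤ _ := mul_le_mul_of_nonneg_left (Real.rpow_le_rpow hc0.le hcb hq) (by positivity)
  have h2 : b ^ p * b ^ (1 + ε + q) ≤ a ^ (p + (1 + ε + q)) := by
    rw [← Real.rpow_add hb0]
    exact Real.rpow_le_rpow_of_nonpos ha0 hab hpq
  calc a ^ p * b ^ p * c ^ q
      ≤ a ^ p * b ^ p * (c ^ (-(1 + ε)) * (2 ^ (1 + ε + q) * b ^ (1 + ε + q))) := by gcongr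
    _ = a ^ p * (b ^ p * b ^ (1 + ε + q)) * (2 ^ (1 + ε + q) * c ^ (-(1 + ε))) := by ring
    _ ≤ a ^ p * a ^ (p + (1 + ε + q)) * (2 ^ (1 + ε + q) * c ^ (-(1 + ε))) := by gcongr
    _ = _ := by rw [← Real.rpow_add ha0, he]; ring

lemma japanesePow_mul_mul_le {p q ε : ℝ} (hq : 0 ≤ 1 + ε + q) (hpq : p + (1 + ε + q) ≤ 0)
    (he : p + (p + (1 + ε + q)) = -(1 + ε)) (u v : ℝ) :
    japanesePow p u * japanesePow p v * japanesePow q (u - v) ≤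
      ENNReal.ofReal (2 ^ (1 + ε + q)) *
        (japanesePow (-(1 + ε)) u * japanesePow (-(1 + ε)) (u - v) +
          japanesePow (-(1 + ε)) v * japanesePow (-(1 + ε)) (u - v)) := by
  have htri : max 1 |u - v| ≤ max 1 |u| + max 1 |v| := by
    refine max_le ?_ ((abs_sub u v).trans (add_le_add (le_max_right _ _) (le_max_right _ _)))
    linarith [le_max_left 1 |u|, le_max_left 1 |v|]
  simp only [japanesePow]
  rw [← ENNReal.ofReal_mul (by positivity), ← ENNReal.ofReal_mul (by positivity),
    ← ENNReal.ofReal_mul (by positivity), ← ENNReal.ofReal_mul (by positivity),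
    ← ENNReal.ofReal_add (by positivity) (by positivity), ← ENNReal.ofReal_mul (by positivity)]
  refine ENNReal.ofReal_le_ofReal ?_
  rcases le_total (max 1 |u|) (max 1 |v|) with h | h
  · refine (rpow_mul_rpow_mul_rpow_le (le_max_left _ _) h (le_max_left _ _) (by linarith)
      hq hpq he).trans (mul_le_mul_of_nonneg_left ?_ (by positivity))
    exact le_add_of_nonneg_right (by positivity)
  · rw [mul_comm ((max 1 |u|) ^ p)]
    refine (rpow_mul_rpow_mul_rpow_le (le_max_left _ _) h (le_max_left _ _) (by linarith)
      hq hpq he).trans (mul_le_mul_of_nonneg_left ?_ (by positivity))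
    exact le_add_of_nonneg_left (by positivity)

lemma lintegral_lintegral_mul_sub (F G : ℝ → ENNReal) (hF : Measurable F) (hG : Measurable G) :
    ∫⁻ u, ∫⁻ v, F u * G (u - v) = (∫⁻ u, F u) * ∫⁻ x, G x := by
  have h (u : ℝ) : ∫⁻ v, F u * G (u - v) = F u * ∫⁻ x, G x := by
    rw [lintegral_const_mul _ (by fun_prop), lintegral_sub_left_eq_self G u]
  simp_rw [h]
  rw [lintegral_mul_const _ hF]

lemma lintegral_lintegral_japanesePow_lt_top {β δ : ℝ} (hβδ : 2 * β < δ) (hβ : 0 < β)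
    (hδ : δ < 1) :
    ∫⁻ u, ∫⁻ v, japanesePow (β - 1) u * japanesePow (β - 1) v * japanesePow (-δ) (u - v) < ⊤ := by
  obtain ⟨ε, hε⟩ : ∃ ε, ε = (δ - 2 * β) / 2 := ⟨_, rfl⟩
  have hJ := lintegral_japanesePow_lt_top (p := -(1 + ε)) (by linarith)
  refine lt_of_le_of_lt (lintegral_mono fun u => lintegral_mono fun v =>
    japanesePow_mul_mul_le (ε := ε) (by linarith) (by linarith) (by linarith) u v) ?_
  have h (u : ℝ) : ∫⁻ v, ENNReal.ofReal (2 ^ (1 + ε + -δ)) *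
        (japanesePow (-(1 + ε)) u * japanesePow (-(1 + ε)) (u - v) +
          japanesePow (-(1 + ε)) v * japanesePow (-(1 + ε)) (u - v)) =
      ENNReal.ofReal (2 ^ (1 + ε + -δ)) *
        ((∫⁻ v, japanesePow (-(1 + ε)) u * japanesePow (-(1 + ε)) (u - v)) +
          ∫⁻ v, japanesePow (-(1 + ε)) v * japanesePow (-(1 + ε)) (u - v)) := by
    rw [lintegral_const_mul _ (by fun_prop), lintegral_add_left (by fun_prop)]
  simp_rw [h]
  have hm : Measurable fun u => ∫⁻ v, japanesePow (-(1 + ε)) u * japanesePow (-(1 + ε)) (u - v) :=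
    Measurable.lintegral_prod_right' (f := fun z : ℝ × ℝ =>
      japanesePow (-(1 + ε)) z.1 * japanesePow (-(1 + ε)) (z.1 - z.2)) (by fun_prop)
  rw [lintegral_const_mul' _ _ ENNReal.ofReal_ne_top, lintegral_add_left hm,
    lintegral_lintegral_swap (f := fun u v =>
      japanesePow (-(1 + ε)) v * japanesePow (-(1 + ε)) (u - v))
      (Measurable.aemeasurable (by unfold Function.uncurry; fun_prop))]
  simp_rw [fun u v => japanesePow_sub_comm (-(1 + ε)) v u]
  rw [lintegral_lintegral_mul_sub _ _ (by fun_prop) (by fun_prop)]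
  have := ENNReal.mul_lt_top hJ hJ
  exact ENNReal.mul_lt_top ENNReal.ofReal_lt_top (ENNReal.add_lt_top.2 ⟨this, this⟩)

lemma lintegral_lintegral_add_mul_add_le {f₁ f₂ g W : ℝ → ENNReal} {a b M N : ENNReal}
    (hf₁ : Measurable f₁) (hf₂ : Measurable f₂) (hg : Measurable g) (hW : Measurable W)
    (hW1 : ∀ x, W x ≤ 1) (hWs : ∀ x y, W (x - y) = W (y - x))
    (hM : ∀ u, ∫⁻ v, g v * W (u - v) ≤ M)
    (hN : ∫⁻ u, ∫⁻ v, g u * g v * W (u - v) ≤ N) :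
    ∫⁻ u, ∫⁻ v, (f₁ u + a * g u) * (f₂ v + b * g v) * W (u - v) ≤
      (∫⁻ u, f₁ u) * (∫⁻ v, f₂ v) + b * M * (∫⁻ u, f₁ u) + a * M * (∫⁻ v, f₂ v)
        + a * b * N := by
  have hgf : ∫⁻ u, ∫⁻ v, g u * f₂ v * W (u - v) ≤ M * ∫⁻ v, f₂ v := by
    rw [lintegral_lintegral_swap (f := fun u v => g u * f₂ v * W (u - v))
      (Measurable.aemeasurable (by unfold Function.uncurry; fun_prop)),
      ← lintegral_const_mul _ hf₂]
    refine lintegral_mono fun v => ?_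
    calc ∫⁻ u, g u * f₂ v * W (u - v) = ∫⁻ u, (g u * W (v - u)) * f₂ v :=
          lintegral_congr fun u => by rw [hWs u v]; ring
      _ = (∫⁻ u, g u * W (v - u)) * f₂ v := lintegral_mul_const _ (by fun_prop)
      _ ≤ M * f₂ v := by gcongr; exact hM v
  have hinner (u : ℝ) : ∫⁻ v, (f₁ u + a * g u) * (f₂ v + b * g v) * W (u - v) ≤
      f₁ u * (∫⁻ v, f₂ v) + b * M * f₁ u + a * (∫⁻ v, g u * f₂ v * W (u - v)) +
        a * b * (∫⁻ v, g u * g v * W (u - v)) := by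
    calc ∫⁻ v, (f₁ u + a * g u) * (f₂ v + b * g v) * W (u - v)
        = ∫⁻ v, (f₁ u * (f₂ v * W (u - v)) + b * f₁ u * (g v * W (u - v)) +
            a * (g u * f₂ v * W (u - v)) + a * b * (g u * g v * W (u - v))) :=
          lintegral_congr fun v => by ring
      _ = f₁ u * (∫⁻ v, f₂ v * W (u - v)) + b * f₁ u * (∫⁻ v, g v * W (u - v)) +
            a * (∫⁻ v, g u * f₂ v * W (u - v)) + a * b * (∫⁻ v, g u * g v * W (u - v)) := by
          rw [lintegral_add_left (by fun_prop), lintegral_add_left (by fun_prop),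
            lintegral_add_left (by fun_prop), lintegral_const_mul _ (by fun_prop),
            lintegral_const_mul _ (by fun_prop), lintegral_const_mul _ (by fun_prop),
            lintegral_const_mul _ (by fun_prop)]
      _ ≤ _ := by
          have h1 : ∫⁻ v, f₂ v * W (u - v) ≤ ∫⁻ v, f₂ v :=
            lintegral_mono fun v => mul_le_of_le_one_right' (hW1 _)
          have h2 : b * f₁ u * (∫⁻ v, g v * W (u - v)) ≤ b * M * f₁ u := by
            rw [mul_right_comm]
            gcongr
            exact hM u
          gcongr
  have hm1 : Measurable fun u => ∫⁻ v, g u * f₂ v * W (u - v) :=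
    Measurable.lintegral_prod_right' (f := fun z : ℝ × ℝ => g z.1 * f₂ z.2 * W (z.1 - z.2))
      (by fun_prop)
  have hm2 : Measurable fun u => ∫⁻ v, g u * g v * W (u - v) :=
    Measurable.lintegral_prod_right' (f := fun z : ℝ × ℝ => g z.1 * g z.2 * W (z.1 - z.2))
      (by fun_prop)
  refine (lintegral_mono hinner).trans ?_
  rw [lintegral_add_left (by fun_prop), lintegral_add_left (by fun_prop),
    lintegral_add_left (by fun_prop), lintegral_mul_const _ hf₁, lintegral_const_mul _ hf₁,
    lintegral_const_mul _ hm1, lintegral_const_mul _ hm2, mul_assoc a M]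
  gcongr

lemma ofReal_abs_fracKernel_le_of_neg {β t : ℝ} (hβ : β < 0) (ht : 0 < t) (u : ℝ) :
    ENNReal.ofReal |fracKernel β t u| ≤
      ENNReal.ofReal |β|⁻¹ * powNear β t (t - u) + ENNReal.ofReal |β|⁻¹ * powNear β t (-u) +
        ENNReal.ofReal t * powFar (β - 1) t (-u) := by
  rcases lt_or_ge u 0 with hu | hu
  · rcases le_or_gt (-u) t with h | h
    · refine le_trans ?_ (le_self_add.trans' le_add_self)
      rw [powNear, Set.indicator_of_mem (show -u ∈ Set.Ioc 0 t from ⟨by linarith, h⟩),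
        ← ENNReal.ofReal_mul (by positivity)]
      exact ENNReal.ofReal_le_ofReal (abs_fracKernel_of_neg_exponent_le hβ ht.le hu)
    · refine le_trans ?_ le_add_self
      rw [powFar, Set.indicator_of_mem (show -u ∈ Set.Ioi t from h),
        ← ENNReal.ofReal_mul ht.le]
      exact ENNReal.ofReal_le_ofReal
        (abs_fracKernel_of_neg_le hβ.ne (by linarith) ht.le hu)
  · rcases lt_or_ge u t with h | h
    · refine le_trans ?_ (le_self_add.trans' le_self_add)
      rw [powNear, Set.indicator_of_mem (show t - u ∈ Set.Ioc 0 t from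
        ⟨by linarith, by linarith⟩), ← ENNReal.ofReal_mul (by positivity),
        abs_fracKernel_of_nonneg_lt hβ.ne hu h]
    · simp [fracKernel_of_nonneg_le hβ.ne hu h]

lemma ofReal_abs_fracKernel_le_of_pos {β t : ℝ} (hβ : 0 < β) (hβ1 : β ≤ 1) (ht : 0 < t) (u : ℝ) :
    ENNReal.ofReal |fracKernel β t u| ≤
      ENNReal.ofReal |β|⁻¹ * powNear β t (t - u) + ENNReal.ofReal t * powNear (β - 1) 1 (-u) +
        ENNReal.ofReal t * japanesePow (β - 1) u := by
  rcases lt_or_ge u 0 with hu | hu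
  · have hk := ENNReal.ofReal_le_ofReal (abs_fracKernel_of_neg_le hβ.ne' hβ1 ht.le hu)
    rw [ENNReal.ofReal_mul ht.le] at hk
    refine hk.trans ?_
    rcases le_or_gt (-u) 1 with h | h
    · refine le_trans ?_ (le_self_add.trans' le_add_self)
      rw [powNear, Set.indicator_of_mem (show -u ∈ Set.Ioc 0 1 from ⟨by linarith, h⟩)]
    · refine le_trans ?_ le_add_self
      rw [japanesePow, abs_of_neg hu, max_eq_right h.le]
  · rcases lt_or_ge u t with h | h
    · refine le_trans ?_ (le_self_add.trans' le_self_add)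
      rw [powNear, Set.indicator_of_mem (show t - u ∈ Set.Ioc 0 t from
        ⟨by linarith, by linarith⟩), ← ENNReal.ofReal_mul (by positivity),
        abs_fracKernel_of_nonneg_lt hβ.ne' hu h]
    · simp [fracKernel_of_nonneg_le hβ.ne' hu h]

/-- The kernel is dominated by an integrable part plus, when `β > 0`, a multiple of the
non-integrable profile `max 1 |u| ^ (β - 1)`. -/
lemma exists_fracKernel_decomposition {β δ T : ℝ} (hβ : -1 < β) (hβδ : 2 * β < δ)
    (hδ : δ < 1) :
    ∃ (f : ℝ → ℝ → ENNReal) (g : ℝ → ENNReal) (c M : ENNReal),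
      (∀ t, Measurable (f t)) ∧ Measurable g ∧ c ≠ ⊤ ∧ M ≠ ⊤ ∧
      (∀ t u, 0 < t → t ≤ T →
        ENNReal.ofReal |fracKernel β t u| ≤ f t u + ENNReal.ofReal (t ^ (1 + min β 0)) * g u) ∧
      (∀ t, 0 < t → t ≤ T → ∫⁻ u, f t u ≤ c * ENNReal.ofReal (t ^ (1 + min β 0))) ∧
      (∀ u, ∫⁻ v, g v * japanesePow (-δ) (u - v) ≤ M) ∧
      ∫⁻ u, ∫⁻ v, g u * g v * japanesePow (-δ) (u - v) ≠ ⊤ := by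
  rcases lt_trichotomy β 0 with h | h | h
  · refine ⟨fun t u => ENNReal.ofReal |β|⁻¹ * powNear β t (t - u) +
        ENNReal.ofReal |β|⁻¹ * powNear β t (-u) + ENNReal.ofReal t * powFar (β - 1) t (-u),
      fun _ => 0,
      ENNReal.ofReal (|β|⁻¹ * (β + 1)⁻¹ + |β|⁻¹ * (β + 1)⁻¹ + |β|⁻¹), 0, fun t => by fun_prop,
      measurable_const, ENNReal.ofReal_ne_top, ENNReal.zero_ne_top, fun t u ht _ => ?_,
      fun t ht _ => ?_, by simp, by simp⟩
    · simpa using ofReal_abs_fracKernel_le_of_neg h ht u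
    · have hβ1 : 0 < β + 1 := by linarith
      rw [lintegral_add_left (by fun_prop), lintegral_add_left (by fun_prop),
        lintegral_const_mul _ (by fun_prop), lintegral_const_mul _ (by fun_prop),
        lintegral_const_mul _ (by fun_prop), lintegral_sub_left_eq_self (powNear β t) t,
        lintegral_neg_eq_self (powNear β t), lintegral_neg_eq_self (powFar (β - 1) t),
        lintegral_powNear hβ ht.le, lintegral_powFar (by linarith) ht, sub_add_cancel,
        ← ENNReal.ofReal_mul (by positivity), ← ENNReal.ofReal_mul ht.le,
        ← ENNReal.ofReal_add (by positivity) (by positivity), min_eq_left h.le,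
        ← ENNReal.ofReal_add (by positivity)
          (mul_nonneg ht.le (div_nonneg_of_nonpos (by simp; positivity) h.le)),
        ← ENNReal.ofReal_mul (by positivity)]
      refine ENNReal.ofReal_le_ofReal (le_of_eq ?_)
      rw [add_comm 1 β, Real.rpow_add ht, Real.rpow_one, abs_of_neg h]
      field_simp
  · subst h
    refine ⟨fun t u => Set.indicator (Set.Ioc 0 t) (fun _ => 1) u, fun _ => 0, 1, 0,
      fun t => measurable_const.indicator measurableSet_Ioc, measurable_const,
      ENNReal.one_ne_top, ENNReal.zero_ne_top, fun t u _ _ => ?_, fun t ht _ => ?_,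
      by simp, by simp⟩
    · by_cases hu : u ∈ Set.Ioc 0 t <;> simp [fracKernel, hu]
    · simp [lintegral_indicator measurableSet_Ioc]
  · refine ⟨fun t u => ENNReal.ofReal |β|⁻¹ * powNear β t (t - u) +
        ENNReal.ofReal t * powNear (β - 1) 1 (-u), japanesePow (β - 1),
      ENNReal.ofReal (|β|⁻¹ * (T ^ β * (β + 1)⁻¹) + |β|⁻¹),
      2 * ∫⁻ x, japanesePow (β - 1 + -δ) x, fun t => by fun_prop,
      by fun_prop, ENNReal.ofReal_ne_top,
      ENNReal.mul_ne_top (by simp) (lintegral_japanesePow_lt_top (by linarith)).ne,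
      fun t u ht _ => ?_, fun t ht htT => ?_,
      lintegral_japanesePow_mul_le (by linarith) (by linarith),
      (lintegral_lintegral_japanesePow_lt_top hβδ h hδ).ne⟩
    · simpa [min_eq_right h.le] using ofReal_abs_fracKernel_le_of_pos h (by linarith) ht u
    · have hT : 0 < T := ht.trans_le htT
      rw [lintegral_add_left (by fun_prop),
        lintegral_const_mul _ (by fun_prop), lintegral_const_mul _ (by fun_prop),
        lintegral_sub_left_eq_self (powNear β t) t,
        lintegral_neg_eq_self (powNear (β - 1) 1),
        lintegral_powNear hβ ht.le, lintegral_powNear (by linarith) zero_le_one,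
        sub_add_cancel, Real.one_rpow,
        ← ENNReal.ofReal_mul (by positivity), ← ENNReal.ofReal_mul ht.le,
        ← ENNReal.ofReal_add (by positivity) (by positivity), min_eq_right h.le,
        ← ENNReal.ofReal_mul (by positivity)]
      refine ENNReal.ofReal_le_ofReal ?_
      rw [add_zero, Real.rpow_one, Real.rpow_add ht, Real.rpow_one, abs_of_pos h]
      have := Real.rpow_le_rpow ht.le htT h.le
      calc β⁻¹ * (t ^ β * t / (β + 1)) + t * (1 / β)
          = (β⁻¹ * (t ^ β * (β + 1)⁻¹) + β⁻¹) * t := by field_simp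
        _ ≤ _ := by gcongr

/-- `Q(s,t) = ∫∫ |k_t^{β₁}(u)| |k_s^{β₁}(v)| |u−v|^{0, n(β₂−1)} dv du
≤ C s^{1+min(β₁,0)} t^{1+min(β₁,0)}` for `s, t ∈ (0, T]`, where `C` depends only on
`n, β₁, β₂, T`. -/
theorem Q_bound
    (n : ℕ) (hn : 1 ≤ n) (β₁ β₂ T : ℝ) (hT : 0 < T)
    (hβ₂ : 1 - 1 / (n : ℝ) < β₂ ∧ β₂ < 1)
    (α : ℝ) (hα : α = β₁ + ((n : ℝ) / 2) * (β₂ - 1) + 1) (hα0 : 0 < α) (hα1 : α < 1) :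
    ∃ C : ℝ, 0 < C ∧ ∀ s t : ℝ, 0 < s → s ≤ T → 0 < t → t ≤ T →
      (∫⁻ u : ℝ, ∫⁻ v : ℝ, ENNReal.ofReal
          (|fracKernel β₁ t u| * |fracKernel β₁ s v| *
            truncPow 0 ((n : ℝ) * (β₂ - 1)) (u - v))) ≤
        ENNReal.ofReal (C * s ^ (1 + min β₁ 0) * t ^ (1 + min β₁ 0)) := by
  obtain ⟨hβ₂l, hβ₂u⟩ := hβ₂
  have hn0 : (0 : ℝ) < n := by exact_mod_cast hn
  have hδ1 : (n : ℝ) * (1 - β₂) < 1 := by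
    have := mul_lt_mul_of_pos_left (sub_lt_comm.1 hβ₂l) hn0
    rwa [mul_one_div_cancel hn0.ne'] at this
  have hδ0 : 0 < (n : ℝ) * (1 - β₂) := mul_pos hn0 (by linarith)
  obtain ⟨f, g, c, M, hf, hg, hc, hM, hk, hfi, hgM, hN⟩ :=
    exists_fracKernel_decomposition (β := β₁) (δ := n * (1 - β₂)) (T := T)
      (by linarith) (by linarith) hδ1
  set N := ∫⁻ u, ∫⁻ v, g u * g v * japanesePow (-(n * (1 - β₂))) (u - v)
  have hK : c * c + M * c + M * c + N ≠ ⊤ := by finiteness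
  refine ⟨(c * c + M * c + M * c + N).toReal + 1, by positivity, fun s t hs hsT ht htT => ?_⟩
  calc ∫⁻ u : ℝ, ∫⁻ v : ℝ, ENNReal.ofReal (|fracKernel β₁ t u| * |fracKernel β₁ s v| *
            truncPow 0 ((n : ℝ) * (β₂ - 1)) (u - v))
      ≤ ∫⁻ u, ∫⁻ v, (f t u + ENNReal.ofReal (t ^ (1 + min β₁ 0)) * g u) *
          (f s v + ENNReal.ofReal (s ^ (1 + min β₁ 0)) * g v) *
            japanesePow (-(n * (1 - β₂))) (u - v) := by
        refine lintegral_mono fun u => lintegral_mono fun v => ?_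
        rw [ENNReal.ofReal_mul (by positivity), ENNReal.ofReal_mul (by positivity),
          ofReal_truncPow_zero, show (n : ℝ) * (β₂ - 1) = -(n * (1 - β₂)) by ring]
        gcongr
        · exact hk t u ht htT
        · exact hk s v hs hsT
    _ ≤ _ := lintegral_lintegral_add_mul_add_le (hf t) (hf s) hg (by fun_prop)
        (japanesePow_le_one (by linarith)) (japanesePow_sub_comm _) hgM le_rfl
    _ ≤ (c * ENNReal.ofReal (t ^ (1 + min β₁ 0))) * (c * ENNReal.ofReal (s ^ (1 + min β₁ 0))) +
          ENNReal.ofReal (s ^ (1 + min β₁ 0)) * M * (c * ENNReal.ofReal (t ^ (1 + min β₁ 0))) +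
          ENNReal.ofReal (t ^ (1 + min β₁ 0)) * M * (c * ENNReal.ofReal (s ^ (1 + min β₁ 0))) +
          ENNReal.ofReal (t ^ (1 + min β₁ 0)) * ENNReal.ofReal (s ^ (1 + min β₁ 0)) * N := by
        have h1 := hfi t ht htT
        have h2 := hfi s hs hsT
        gcongr
    _ = (c * c + M * c + M * c + N) * ENNReal.ofReal (s ^ (1 + min β₁ 0)) *
          ENNReal.ofReal (t ^ (1 + min β₁ 0)) := by ring
    _ ≤ _ := by
        rw [ENNReal.ofReal_mul (by positivity), ENNReal.ofReal_mul (by positivity)]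
        gcongr
        exact (ENNReal.ofReal_toReal hK).symm.trans_le
          (ENNReal.ofReal_le_ofReal (by linarith))
end

section
/- Let n ≥ 1 be an integer, β₁ ∈ ℝ with β₁ ≠ 0, β₂ ∈ (1 − 1/n, 1), T > 0, and suppose α := β₁ + (n/2)(β₂ − 1) + 1 satisfies 0 < α < 1. Then there are constants 0 < c ≤ C, depending only on n, β₁, β₂ and T, such that for all s ∈ (0, T] and all u ∈ ℝ: c · s^{1+min(β₁,0)} · |u|^{0, n(β₂−1)+max(β₁,0)} ≤ ∫_{ℝ} |k_s^{β₁}(−v)| · |u − v|^{0, n(β₂−1)} dv ≤ C · s^{1+min(β₁,0)} · |u|^{0, n(β₂−1)+max(β₁,0)}. -/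
open MeasureTheory

/-- The power `|x|^p` restricted to the ball `|x| ≤ R`. -/
noncomputable def ballPow (p R x : ℝ) : ℝ := if |x| ≤ R then |x| ^ p else 0

/-- The power `|x|^p` restricted to the complement of the ball `|x| ≤ R`. -/
noncomputable def tailPow (p R x : ℝ) : ℝ := if R < |x| then |x| ^ p else 0

lemma ballPow_nonneg (p R x : ℝ) : 0 ≤ ballPow p R x := by
  unfold ballPow; split_ifs <;> positivity

lemma tailPow_nonneg (p R x : ℝ) : 0 ≤ tailPow p R x := by
  unfold tailPow; split_ifs <;> positivity

lemma integral_ballPow {p R : ℝ} (hp : -1 < p) (hR : 0 < R) :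
    ∫ x, ballPow p R x = 2 / (p + 1) * R ^ (p + 1) := by
  have h := integral_comp_abs (f := (Set.Iic R).indicator fun x : ℝ => x ^ p)
  have heq : ∀ x, ballPow p R x = (Set.Iic R).indicator (fun x : ℝ => x ^ p) |x| := fun x => by
    simp [ballPow, Set.indicator_apply]
  simp_rw [heq]
  rw [h, setIntegral_indicator measurableSet_Iic, Set.Ioi_inter_Iic,
    ← intervalIntegral.integral_of_le hR.le, integral_rpow (Or.inl hp),
    Real.zero_rpow (by linarith)]
  ring

lemma integral_tailPow {p R : ℝ} (hp : p < -1) (hR : 0 < R) :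
    ∫ x, tailPow p R x = 2 / (-(p + 1)) * R ^ (p + 1) := by
  have h := integral_comp_abs (f := (Set.Ioi R).indicator fun x : ℝ => x ^ p)
  have heq : ∀ x, tailPow p R x = (Set.Ioi R).indicator (fun x : ℝ => x ^ p) |x| := fun x => by
    simp [tailPow, Set.indicator_apply]
  simp_rw [heq]
  rw [h, setIntegral_indicator measurableSet_Ioi, Set.Ioi_inter_Ioi, max_eq_right hR.le,
    integral_Ioi_rpow_of_lt hp hR, div_neg, neg_div]
  ring

lemma integrable_ballPow {p R : ℝ} (hp : -1 < p) (hR : 0 < R) : Integrable (ballPow p R) := by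
  refine Integrable.of_integral_ne_zero ?_
  rw [integral_ballPow hp hR]
  have : 0 < p + 1 := by linarith
  positivity

lemma integrable_tailPow {p R : ℝ} (hp : p < -1) (hR : 0 < R) : Integrable (tailPow p R) := by
  refine Integrable.of_integral_ne_zero ?_
  rw [integral_tailPow hp hR]
  have : 0 < -(p + 1) := by linarith
  positivity

lemma fracKernel_neg {β s v : ℝ} (hβ : β ≠ 0) :
    fracKernel β s (-v) = 1 / β * ((max (s + v) 0) ^ β - (max v 0) ^ β) := by
  simp [fracKernel, hβ]

lemma measurable_fracKernel_neg {β s : ℝ} (hβ : β ≠ 0) :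
    Measurable fun v => fracKernel β s (-v) := by
  simp_rw [fracKernel_neg hβ]
  fun_prop

lemma measurable_truncPow (γ₁ γ₂ : ℝ) : Measurable (truncPow γ₁ γ₂) := by
  unfold truncPow
  exact Measurable.ite (measurableSet_lt (by fun_prop) (by fun_prop)) (by fun_prop) (by fun_prop)

lemma fracKernel_neg_of_le {β s v : ℝ} (hβ : β ≠ 0) (hs : 0 < s) (hv : v ≤ -s) :
    fracKernel β s (-v) = 0 := by
  rw [fracKernel_neg hβ, max_eq_right (by linarith), max_eq_right (by linarith)]
  ring

lemma abs_fracKernel_neg_of_nonpos {β s v : ℝ} (hβ : β ≠ 0) (hv : -s < v) (hv0 : v ≤ 0) :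
    |fracKernel β s (-v)| = (s + v) ^ β / |β| := by
  have hsv : 0 < s + v := by linarith
  rw [fracKernel_neg hβ, max_eq_left hsv.le, max_eq_right hv0, Real.zero_rpow hβ, sub_zero,
    abs_mul, abs_div, abs_one, abs_of_pos (Real.rpow_pos_of_pos hsv β)]
  ring

lemma abs_fracKernel_neg_of_pos {β s v : ℝ} (hβ : β ≠ 0) (hs : 0 < s) (hv : 0 < v) :
    ∃ ξ, v < ξ ∧ ξ < s + v ∧ |fracKernel β s (-v)| = s * ξ ^ (β - 1) := by
  obtain ⟨ξ, ⟨h1, h2⟩, h⟩ := exists_hasDerivAt_eq_slope (fun x : ℝ => x ^ β)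
    (fun x => β * x ^ (β - 1)) (show v < s + v by linarith)
    (fun x hx => (Real.continuousAt_rpow_const x β
      (Or.inl (by linarith [hx.1]))).continuousWithinAt)
    (fun x hx => Real.hasDerivAt_rpow_const (Or.inl (by linarith [hx.1])))
  refine ⟨ξ, h1, h2, ?_⟩
  have hξ : 0 < ξ := hv.trans h1
  rw [fracKernel_neg hβ, max_eq_left (by linarith), max_eq_left hv.le]
  have : (s + v) ^ β - v ^ β = β * (s * ξ ^ (β - 1)) := by
    have hne : s + v - v ≠ 0 := by simpa using hs.ne'
    rw [eq_div_iff hne] at h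
    rw [← h]; ring
  rw [this, ← mul_assoc, one_div, inv_mul_cancel₀ hβ, one_mul, abs_of_nonneg (by positivity)]

lemma abs_fracKernel_neg_le_of_pos_s12 {β s v : ℝ} (hβ : β ≠ 0) (hβ1 : β ≤ 1) (hs : 0 < s)
    (hv : 0 < v) : |fracKernel β s (-v)| ≤ s * v ^ (β - 1) := by
  obtain ⟨ξ, h1, -, h⟩ := abs_fracKernel_neg_of_pos hβ hs hv
  rw [h]
  exact mul_le_mul_of_nonneg_left (Real.rpow_le_rpow_of_nonpos hv h1.le (by linarith)) hs.le

lemma le_abs_fracKernel_neg_of_pos {β s v : ℝ} (hβ : β ≠ 0) (hβ1 : β ≤ 1) (hs : 0 < s)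
    (hv : 0 < v) : s * (s + v) ^ (β - 1) ≤ |fracKernel β s (-v)| := by
  obtain ⟨ξ, h1, h2, h⟩ := abs_fracKernel_neg_of_pos hβ hs hv
  rw [h]
  exact mul_le_mul_of_nonneg_left
    (Real.rpow_le_rpow_of_nonpos (hv.trans h1) h2.le (by linarith)) hs.le

lemma abs_fracKernel_neg_le_rpow {β s v : ℝ} (hβ : β < 0) (hs : 0 < s) (hv : 0 < v) :
    |fracKernel β s (-v)| ≤ v ^ β / |β| := by
  have hsv : (s + v) ^ β ≤ v ^ β := Real.rpow_le_rpow_of_nonpos hv (by linarith) hβ.le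
  have h0 : 0 < (s + v) ^ β := by positivity
  rw [fracKernel_neg hβ.ne, max_eq_left (by linarith), max_eq_left hv.le, abs_mul, abs_div,
    abs_one, abs_of_nonpos (sub_nonpos.2 hsv), div_mul_eq_mul_div, one_mul]
  gcongr
  linarith

/-- For nonpositive exponents the truncated power is comparable to `(1 + |x|)^γ`. -/
lemma one_add_abs_rpow_le_truncPow {γ : ℝ} (hγ : γ ≤ 0) (x : ℝ) :
    (1 + |x|) ^ γ ≤ truncPow 0 γ x := by
  have hx := abs_nonneg x
  unfold truncPow
  split_ifs with h
  · rw [Real.rpow_zero]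
    exact Real.rpow_le_one_of_one_le_of_nonpos (by linarith) hγ
  · exact Real.rpow_le_rpow_of_nonpos (by linarith) (by linarith) hγ

lemma truncPow_le_one_add_abs_rpow {γ : ℝ} (hγ : γ ≤ 0) (x : ℝ) :
    truncPow 0 γ x ≤ 2 ^ (-γ) * (1 + |x|) ^ γ := by
  have hx := abs_nonneg x
  have key : ∀ y : ℝ, 0 < y → 1 + |x| ≤ 2 * y → y ^ γ ≤ 2 ^ (-γ) * (1 + |x|) ^ γ := by
    intro y hy h
    calc y ^ γ = 2 ^ (-γ) * (2 * y) ^ γ := by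
          rw [Real.mul_rpow (by norm_num) hy.le, ← mul_assoc, ← Real.rpow_add (by norm_num)]
          simp
      _ ≤ _ := by
          gcongr 2 ^ (-γ) * ?_
          exact Real.rpow_le_rpow_of_nonpos (by positivity) h hγ
  unfold truncPow
  split_ifs with h
  · simpa using key 1 one_pos (by linarith)
  · exact key |x| (by linarith) (by linarith)

lemma truncPow_nonneg (γ₁ γ₂ x : ℝ) : 0 ≤ truncPow γ₁ γ₂ x := by
  unfold truncPow; split_ifs <;> positivity

/-- Bounding a truncated power at `x` by the scale of a comparison radius `R`. -/
lemma truncPow_le_of_le {γ : ℝ} (hγ : γ ≤ 0) {x r k : ℝ} (hr : 0 < r) (hk : 0 < k)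
    (h : r ≤ k * (1 + |x|)) : truncPow 0 γ x ≤ (2 * k) ^ (-γ) * r ^ γ := by
  have h1 : 0 < 1 + |x| := by positivity
  calc truncPow 0 γ x ≤ 2 ^ (-γ) * (1 + |x|) ^ γ := truncPow_le_one_add_abs_rpow hγ x
    _ = (2 * k) ^ (-γ) * (k * (1 + |x|)) ^ γ := by
        rw [Real.mul_rpow hk.le h1.le, Real.mul_rpow (by norm_num) hk.le, Real.rpow_neg hk.le]
        have := (Real.rpow_pos_of_pos hk γ).ne'
        field_simp
    _ ≤ _ := by
        gcongr (2 * k) ^ (-γ) * ?_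
        exact Real.rpow_le_rpow_of_nonpos hr h hγ

lemma le_truncPow_of_le {γ : ℝ} (hγ : γ ≤ 0) {x r k : ℝ} (hr : 0 < r) (hk : 0 < k)
    (h : 1 + |x| ≤ k * r) : k ^ γ * r ^ γ ≤ truncPow 0 γ x := by
  rw [← Real.mul_rpow hk.le hr.le]
  exact (Real.rpow_le_rpow_of_nonpos (by positivity) h hγ).trans
    (one_add_abs_rpow_le_truncPow hγ x)

/-- `f` is integrable with integral `a`. -/
def HasIntegralEq (f : ℝ → ℝ) (a : ℝ) : Prop := Integrable f ∧ ∫ x, f x = a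

lemma HasIntegralEq.add {f g : ℝ → ℝ} {a b : ℝ} (hf : HasIntegralEq f a)
    (hg : HasIntegralEq g b) : HasIntegralEq (fun x => f x + g x) (a + b) :=
  ⟨hf.1.add hg.1, by rw [integral_add hf.1 hg.1, hf.2, hg.2]⟩

lemma HasIntegralEq.const_mul {f : ℝ → ℝ} {a : ℝ} (c : ℝ) (hf : HasIntegralEq f a) :
    HasIntegralEq (fun x => c * f x) (c * a) :=
  ⟨hf.1.const_mul c, by rw [integral_const_mul, hf.2]⟩

lemma HasIntegralEq.comp_add_right {f : ℝ → ℝ} {a : ℝ} (hf : HasIntegralEq f a) (t : ℝ) :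
    HasIntegralEq (fun x => f (x + t)) a :=
  ⟨hf.1.comp_add_right t, by rw [integral_add_right_eq_self f t, hf.2]⟩

lemma HasIntegralEq.comp_sub_left {f : ℝ → ℝ} {a : ℝ} (hf : HasIntegralEq f a) (t : ℝ) :
    HasIntegralEq (fun x => f (t - x)) a :=
  ⟨hf.1.comp_sub_left t, by rw [integral_sub_left_eq_self f volume t, hf.2]⟩

lemma hasIntegralEq_ballPow {p R : ℝ} (hp : -1 < p) (hR : 0 < R) :
    HasIntegralEq (ballPow p R) (2 / (p + 1) * R ^ (p + 1)) :=
  ⟨integrable_ballPow hp hR, integral_ballPow hp hR⟩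

lemma hasIntegralEq_tailPow {p R : ℝ} (hp : p < -1) (hR : 0 < R) :
    HasIntegralEq (tailPow p R) (2 / (-(p + 1)) * R ^ (p + 1)) :=
  ⟨integrable_tailPow hp hR, integral_tailPow hp hR⟩

lemma one_add_abs_le_mul (u v : ℝ) : 1 + |u| ≤ (1 + |v|) * (1 + |u - v|) := by
  have h : |u| ≤ |v| + |u - v| := by simpa using abs_add_le v (u - v)
  nlinarith [abs_nonneg v, abs_nonneg (u - v)]

/-- The integrand of the convolution. -/
noncomputable def convIntegrand (β γ s u v : ℝ) : ℝ :=
  |fracKernel β s (-v)| * truncPow 0 γ (u - v)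

lemma convIntegrand_nonneg (β γ s u v : ℝ) : 0 ≤ convIntegrand β γ s u v :=
  mul_nonneg (abs_nonneg _) (truncPow_nonneg _ _ _)

lemma measurable_convIntegrand {β : ℝ} (hβ : β ≠ 0) (γ s u : ℝ) :
    Measurable (convIntegrand β γ s u) :=
  (measurable_fracKernel_neg hβ).abs.mul
    ((measurable_truncPow 0 γ).comp (measurable_const.sub measurable_id))

lemma convIntegrand_integrable_and_le {β γ s u a : ℝ} (hβ : β ≠ 0) {g : ℝ → ℝ}
    (hg : HasIntegralEq g a) (h : ∀ v, v ≠ u → convIntegrand β γ s u v ≤ g v) :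
    Integrable (convIntegrand β γ s u) ∧ ∫ v, convIntegrand β γ s u v ≤ a := by
  have hae : ∀ᵐ v, convIntegrand β γ s u v ≤ g v := by
    filter_upwards [compl_mem_ae_iff.2 (measure_singleton u)] with v hv using h v hv
  have hi : Integrable (convIntegrand β γ s u) := by
    refine hg.1.mono' (measurable_convIntegrand hβ γ s u).aestronglyMeasurable ?_
    filter_upwards [hae] with v hv
    rwa [Real.norm_of_nonneg (convIntegrand_nonneg β γ s u v)]
  exact ⟨hi, (integral_mono_ae hi hg.1 hae).trans_eq hg.2⟩

lemma convIntegrand_le_of_near {β γ s u v : ℝ} (hβ : β ≠ 0) (hβ1 : β ≤ 1) (hγ : γ ≤ 0)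
    (hs : 0 < s) (hv : 0 < v) (hvu : v ≠ u) (h : 2 * (1 + |u - v|) < 1 + |u|) :
    convIntegrand β γ s u v ≤
      2 ^ (1 - β) * 2 ^ (-γ) * (s * (1 + |u|) ^ (β - 1)) * ballPow γ (1 + |u|) (u - v) := by
  have hx : 0 < |u - v| := abs_pos.2 (sub_ne_zero.2 hvu.symm)
  have hR : 0 < 1 + |u| := by positivity
  have hu : |u| ≤ v + |u - v| := by simpa [abs_of_pos hv] using abs_add_le v (u - v)
  have hK : |fracKernel β s (-v)| ≤ s * (2 ^ (1 - β) * (1 + |u|) ^ (β - 1)) := by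
    refine (abs_fracKernel_neg_le_of_pos_s12 hβ hβ1 hs hv).trans ?_
    gcongr s * ?_
    calc v ^ (β - 1) ≤ (2⁻¹ * (1 + |u|)) ^ (β - 1) :=
          Real.rpow_le_rpow_of_nonpos (by positivity) (by linarith) (by linarith)
      _ = 2 ^ (1 - β) * (1 + |u|) ^ (β - 1) := by
          rw [Real.mul_rpow (by norm_num) hR.le, Real.inv_rpow (by norm_num),
            ← Real.rpow_neg (by norm_num), neg_sub]
  have hw : truncPow 0 γ (u - v) ≤ 2 ^ (-γ) * ballPow γ (1 + |u|) (u - v) := by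
    rw [ballPow, if_pos (by linarith)]
    simpa using truncPow_le_of_le hγ (k := 1) hx one_pos (by linarith)
  calc convIntegrand β γ s u v
      ≤ (s * (2 ^ (1 - β) * (1 + |u|) ^ (β - 1))) * (2 ^ (-γ) * ballPow γ (1 + |u|) (u - v)) :=
        mul_le_mul hK hw (truncPow_nonneg _ _ _) (by positivity)
    _ = _ := by ring

lemma truncPow_sub_le_of_mem_Ioc {γ s T u v : ℝ} (hγ : γ ≤ 0) (hsT : s ≤ T) (hv : -s < v)
    (hv0 : v ≤ 0) : truncPow 0 γ (u - v) ≤ (2 * (2 + T)) ^ (-γ) * (1 + |u|) ^ γ := by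
  refine truncPow_le_of_le hγ (by positivity) (by linarith) ?_
  refine (one_add_abs_le_mul u v).trans ?_
  gcongr ?_ * _
  rw [abs_of_nonpos hv0]; linarith

lemma truncPow_sub_le_of_far {γ T u v : ℝ} (hγ : γ ≤ 0) (hT : 0 < T)
    (h : 1 + |u| ≤ 2 * (1 + |u - v|)) :
    truncPow 0 γ (u - v) ≤ (2 * (2 + T)) ^ (-γ) * (1 + |u|) ^ γ := by
  refine truncPow_le_of_le hγ (by positivity) (by linarith) (h.trans ?_)
  gcongr
  linarith

/-- Upper bound for a negative first exponent. -/
lemma convIntegrand_upper_of_neg {β γ T : ℝ} (hβ : β < 0) (hβ1 : -1 < β) (hγ : γ < 0)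
    (hγ1 : -1 < γ) (hT : 0 < T) :
    ∃ C, ∀ s, 0 < s → s ≤ T → ∀ u, Integrable (convIntegrand β γ s u) ∧
      ∫ v, convIntegrand β γ s u v ≤ C * s ^ (1 + β) * (1 + |u|) ^ γ := by
  set A : ℝ := (2 * (2 + T)) ^ (-γ)
  set B : ℝ := 2 ^ (1 - β) * 2 ^ (-γ)
  have hA0 : 0 ≤ A := by positivity
  have hB0 : 0 ≤ B := by positivity
  refine ⟨A * (4 / (|β| * (β + 1)) + 2 / (-β)) + B * T ^ (-β) * (2 / (γ + 1)),
    fun s hs hsT u => ?_⟩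
  set R : ℝ := 1 + |u| with hR
  have hR1 : 1 ≤ R := by rw [hR]; linarith [abs_nonneg u]
  have hR0 : 0 < R := by linarith
  have hg := (((((hasIntegralEq_ballPow hβ1 hs).comp_add_right s).add
    (hasIntegralEq_ballPow hβ1 hs)).const_mul |β|⁻¹).add
    ((hasIntegralEq_tailPow (p := β - 1) (by linarith) hs).const_mul s)).const_mul (A * R ^ γ)
    |>.add (((hasIntegralEq_ballPow hγ1 hR0).comp_sub_left u).const_mul (B * (s * R ^ (β - 1))))
  have hdom : ∀ v, v ≠ u → convIntegrand β γ s u v ≤ A * R ^ γ *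
      (|β|⁻¹ * (ballPow β s (v + s) + ballPow β s v) + s * tailPow (β - 1) s v) +
      B * (s * R ^ (β - 1)) * ballPow γ R (u - v) := by
    intro v hvu
    have p1 := ballPow_nonneg β s (v + s)
    have p2 := ballPow_nonneg β s v
    have p3 := tailPow_nonneg (β - 1) s v
    have p4 := ballPow_nonneg γ R (u - v)
    have q4 : 0 ≤ B * (s * R ^ (β - 1)) * ballPow γ R (u - v) := by positivity
    have main : |fracKernel β s (-v)| ≤
          |β|⁻¹ * (ballPow β s (v + s) + ballPow β s v) + s * tailPow (β - 1) s v →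
        truncPow 0 γ (u - v) ≤ A * R ^ γ → convIntegrand β γ s u v ≤ A * R ^ γ *
          (|β|⁻¹ * (ballPow β s (v + s) + ballPow β s v) + s * tailPow (β - 1) s v) +
          B * (s * R ^ (β - 1)) * ballPow γ R (u - v) := by
      intro h1 h2
      have := mul_le_mul h1 h2 (truncPow_nonneg _ _ _) (by positivity)
      unfold convIntegrand
      linarith
    rcases le_or_gt v (-s) with hv | hv
    · rw [convIntegrand, fracKernel_neg_of_le hβ.ne hs hv]
      simp only [abs_zero, zero_mul]
      positivity
    rcases le_or_gt v 0 with hv0 | hv0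
    · refine main ?_ (truncPow_sub_le_of_mem_Ioc hγ.le hsT hv hv0)
      have hb : ballPow β s (v + s) = (s + v) ^ β := by
        rw [ballPow, abs_of_pos (by linarith), if_pos (by linarith), add_comm]
      rw [abs_fracKernel_neg_of_nonpos hβ.ne hv hv0, hb, div_eq_inv_mul]
      have : 0 ≤ |β|⁻¹ * ballPow β s v := by positivity
      have : 0 ≤ s * tailPow (β - 1) s v := by positivity
      linarith
    rcases lt_or_ge (2 * (1 + |u - v|)) R with hn | hf
    · refine (convIntegrand_le_of_near hβ.ne (by linarith) hγ.le hs hv0 hvu hn).trans ?_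
      have : 0 ≤ A * R ^ γ * (|β|⁻¹ * (ballPow β s (v + s) + ballPow β s v) +
          s * tailPow (β - 1) s v) := by positivity
      linarith
    · refine main ?_ (truncPow_sub_le_of_far hγ.le hT hf)
      rcases le_or_gt v s with hvs | hvs
      · have hb : ballPow β s v = v ^ β := by rw [ballPow, abs_of_pos hv0, if_pos hvs]
        have := abs_fracKernel_neg_le_rpow hβ hs hv0
        rw [div_eq_inv_mul] at this
        have : 0 ≤ |β|⁻¹ * ballPow β s (v + s) := by positivity
        have : 0 ≤ s * tailPow (β - 1) s v := by positivity
        rw [hb]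
        linarith
      · have hb : tailPow (β - 1) s v = v ^ (β - 1) := by
          rw [tailPow, abs_of_pos hv0, if_pos hvs]
        have := abs_fracKernel_neg_le_of_pos_s12 hβ.ne (by linarith) hs hv0
        have : 0 ≤ |β|⁻¹ * (ballPow β s (v + s) + ballPow β s v) := by positivity
        rw [hb]
        linarith
  obtain ⟨hi, hle⟩ := convIntegrand_integrable_and_le hβ.ne hg hdom
  refine ⟨hi, hle.trans ?_⟩
  have e1 : s * s ^ (β - 1 + 1) = s ^ (1 + β) := by
    rw [sub_add_cancel, Real.rpow_add hs, Real.rpow_one]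
  have e2 : R ^ (β - 1) * R ^ (γ + 1) ≤ R ^ γ := by
    rw [← Real.rpow_add hR0]
    exact Real.rpow_le_rpow_of_exponent_le hR1 (by linarith)
  have e3 : s ≤ T ^ (-β) * s ^ (1 + β) := by
    calc s = s ^ (-β) * s ^ (1 + β) := by
          rw [← Real.rpow_add hs]; simp
      _ ≤ _ := by gcongr; linarith
  have hγ' : 0 < 2 / (γ + 1) := div_pos two_pos (by linarith)
  have e4 : s * (R ^ (β - 1) * R ^ (γ + 1)) ≤ T ^ (-β) * s ^ (1 + β) * R ^ γ :=
    mul_le_mul e3 e2 (by positivity) (by positivity)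
  have hβ' : β + 1 ≠ 0 := by linarith
  have hβa : |β| ≠ 0 := abs_ne_zero.2 hβ.ne
  calc _ = A * R ^ γ * (4 / (|β| * (β + 1)) * s ^ (1 + β) + 2 / (-β) * (s * s ^ (β - 1 + 1))) +
          B * (2 / (γ + 1)) * (s * (R ^ (β - 1) * R ^ (γ + 1))) := by
        rw [add_comm 1 β, sub_add_cancel]
        field_simp
        ring
    _ ≤ A * R ^ γ * (4 / (|β| * (β + 1)) * s ^ (1 + β) + 2 / (-β) * (s ^ (1 + β))) +
          B * (2 / (γ + 1)) * (T ^ (-β) * s ^ (1 + β) * R ^ γ) := by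
        rw [e1]; gcongr
    _ = _ := by ring

/-- Upper bound for a positive first exponent. -/
lemma convIntegrand_upper_of_pos {β γ T : ℝ} (hβ : 0 < β) (hβγ : β + γ < 0)
    (hγ1 : -1 < γ) (hT : 0 < T) :
    ∃ C, ∀ s, 0 < s → s ≤ T → ∀ u, Integrable (convIntegrand β γ s u) ∧
      ∫ v, convIntegrand β γ s u v ≤ C * s * (1 + |u|) ^ (γ + β) := by
  have hγ : γ < 0 := by linarith
  have hβ1 : β ≤ 1 := by linarith
  set A : ℝ := (2 * (2 + T)) ^ (-γ)
  set D : ℝ := (2 * 2) ^ (-γ)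
  set B : ℝ := 2 ^ (1 - β) * 2 ^ (-γ)
  have hA0 : 0 ≤ A := by positivity
  have hD0 : 0 ≤ D := by positivity
  have hB0 : 0 ≤ B := by positivity
  refine ⟨A * (2 / β) * T ^ β + A * (2 / β) * 2 ^ β + D * (2 / (-(β + γ))) * 2 ^ (β + γ) +
    B * (2 / (γ + 1)), fun s hs hsT u => ?_⟩
  set R : ℝ := 1 + |u| with hR
  have hR1 : 1 ≤ R := by rw [hR]; linarith [abs_nonneg u]
  have hR0 : 0 < R := by linarith
  have hg := ((((hasIntegralEq_ballPow (p := 0) (by norm_num) hs).const_mul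
    (A * R ^ γ * (s ^ β / β))).add
    ((hasIntegralEq_ballPow (p := β - 1) (R := 2 * R) (by linarith) (by linarith)).const_mul
      (A * R ^ γ * s))).add
    ((hasIntegralEq_tailPow (p := β - 1 + γ) (R := 2 * R) (by linarith) (by linarith)).const_mul
      (D * s))).add
    (((hasIntegralEq_ballPow hγ1 hR0).comp_sub_left u).const_mul (B * (s * R ^ (β - 1))))
  have hdom : ∀ v, v ≠ u → convIntegrand β γ s u v ≤ A * R ^ γ * (s ^ β / β) * ballPow 0 s v +
      A * R ^ γ * s * ballPow (β - 1) (2 * R) v + D * s * tailPow (β - 1 + γ) (2 * R) v +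
      B * (s * R ^ (β - 1)) * ballPow γ R (u - v) := by
    intro v hvu
    have p1 := ballPow_nonneg 0 s v
    have p2 := ballPow_nonneg (β - 1) (2 * R) v
    have p3 := tailPow_nonneg (β - 1 + γ) (2 * R) v
    have p4 := ballPow_nonneg γ R (u - v)
    have q1 : 0 ≤ A * R ^ γ * (s ^ β / β) * ballPow 0 s v := by positivity
    have q2 : 0 ≤ A * R ^ γ * s * ballPow (β - 1) (2 * R) v := by positivity
    have q3 : 0 ≤ D * s * tailPow (β - 1 + γ) (2 * R) v := by positivity
    have q4 : 0 ≤ B * (s * R ^ (β - 1)) * ballPow γ R (u - v) := by positivity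
    rcases le_or_gt v (-s) with hv | hv
    · rw [convIntegrand, fracKernel_neg_of_le hβ.ne' hs hv]
      simp only [abs_zero, zero_mul]
      positivity
    rcases le_or_gt v 0 with hv0 | hv0
    · have hb : ballPow 0 s v = 1 := by
        rw [ballPow, if_pos (by rw [abs_of_nonpos hv0]; linarith), Real.rpow_zero]
      have hK : |fracKernel β s (-v)| ≤ s ^ β / β := by
        rw [abs_fracKernel_neg_of_nonpos hβ.ne' hv hv0, abs_of_pos hβ]
        gcongr <;> linarith
      have := mul_le_mul hK (truncPow_sub_le_of_mem_Ioc (u := u) hγ.le hsT hv hv0)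
        (truncPow_nonneg _ _ _) (by positivity)
      rw [hb] at *
      unfold convIntegrand
      linarith
    rcases lt_or_ge (2 * (1 + |u - v|)) R with hn | hf
    · linarith [convIntegrand_le_of_near hβ.ne' hβ1 hγ.le hs hv0 hvu hn]
    have hK := abs_fracKernel_neg_le_of_pos_s12 hβ.ne' hβ1 hs hv0
    rcases le_or_gt v (2 * R) with hvR | hvR
    · have hb : ballPow (β - 1) (2 * R) v = v ^ (β - 1) := by
        rw [ballPow, abs_of_pos hv0, if_pos hvR]
      have := mul_le_mul hK (truncPow_sub_le_of_far hγ.le hT hf)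
        (truncPow_nonneg _ _ _) (by positivity)
      rw [hb] at *
      unfold convIntegrand
      linarith
    · have hb : tailPow (β - 1 + γ) (2 * R) v = v ^ (β - 1) * v ^ γ := by
        rw [tailPow, abs_of_pos hv0, if_pos hvR, Real.rpow_add hv0]
      have hu : v ≤ |u| + |u - v| := by linarith [le_abs_self u, neg_abs_le (u - v)]
      have := mul_le_mul hK (truncPow_le_of_le hγ.le (x := u - v) (k := 2) hv0 two_pos
        (by linarith)) (truncPow_nonneg _ _ _) (by positivity)
      rw [hb] at *
      unfold convIntegrand
      linarith
  obtain ⟨hi, hle⟩ := convIntegrand_integrable_and_le hβ.ne' hg hdom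
  refine ⟨hi, hle.trans ?_⟩
  have e1 : R ^ γ ≤ R ^ (γ + β) := Real.rpow_le_rpow_of_exponent_le hR1 (by linarith)
  have e2 : s ^ β ≤ T ^ β := by gcongr
  have e3 : R ^ γ * (2 * R) ^ β = 2 ^ β * R ^ (γ + β) := by
    rw [Real.mul_rpow two_pos.le hR0.le, Real.rpow_add hR0]; ring
  have e4 : (2 * R) ^ (β + γ) = 2 ^ (β + γ) * R ^ (γ + β) := by
    rw [Real.mul_rpow two_pos.le hR0.le, add_comm γ β]
  have e5 : R ^ (β - 1) * R ^ (γ + 1) = R ^ (γ + β) := by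
    rw [← Real.rpow_add hR0]; congr 1; ring
  have e6 : β - 1 + γ + 1 = β + γ := by ring
  calc _ = A * (2 / β) * s * (R ^ γ * s ^ β) + A * (2 / β) * s * (R ^ γ * (2 * R) ^ β) +
          D * (2 / (-(β + γ))) * s * (2 * R) ^ (β + γ) +
          B * (2 / (γ + 1)) * s * (R ^ (β - 1) * R ^ (γ + 1)) := by
        rw [e6, sub_add_cancel, zero_add, Real.rpow_one]
        ring
    _ ≤ A * (2 / β) * s * (R ^ (γ + β) * T ^ β) + A * (2 / β) * s * (R ^ γ * (2 * R) ^ β) +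
          D * (2 / (-(β + γ))) * s * (2 * R) ^ (β + γ) +
          B * (2 / (γ + 1)) * s * (R ^ (β - 1) * R ^ (γ + 1)) := by
        gcongr
    _ = _ := by rw [e3, e4, e5]; ring

lemma mul_sub_le_integral_of_le {f : ℝ → ℝ} {a b c : ℝ} (hab : a ≤ b) (hf : Integrable f)
    (hf0 : ∀ x, 0 ≤ f x) (h : ∀ x ∈ Set.Ioo a b, c ≤ f x) : c * (b - a) ≤ ∫ x, f x := by
  calc c * (b - a) = ∫ _ in Set.Ioo a b, c := by
        simp [hab, mul_comm]
    _ ≤ ∫ x in Set.Ioo a b, f x :=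
        setIntegral_mono_on (integrableOn_const (by simp)) hf.integrableOn measurableSet_Ioo h
    _ ≤ ∫ x, f x := setIntegral_le_integral hf (Filter.Eventually.of_forall hf0)

/-- Lower bound for a negative first exponent. -/
lemma convIntegrand_lower_of_neg {β γ s T u : ℝ} (hβ : β < 0) (hγ : γ < 0) (hs : 0 < s)
    (hsT : s ≤ T) (hi : Integrable (convIntegrand β γ s u)) :
    (1 + T) ^ γ / |β| * s ^ (1 + β) * (1 + |u|) ^ γ ≤ ∫ v, convIntegrand β γ s u v := by
  have h : ∀ v ∈ Set.Ioo (-s) 0,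
      s ^ β / |β| * ((1 + T) ^ γ * (1 + |u|) ^ γ) ≤ convIntegrand β γ s u v := by
    rintro v ⟨hv, hv0⟩
    refine mul_le_mul ?_ (le_truncPow_of_le hγ.le (by positivity) (by linarith) ?_)
      (mul_nonneg (Real.rpow_nonneg (by linarith) _) (by positivity)) (abs_nonneg _)
    · rw [abs_fracKernel_neg_of_nonpos hβ.ne hv hv0.le]
      exact div_le_div_of_nonneg_right
        (Real.rpow_le_rpow_of_nonpos (by linarith) (by linarith) hβ.le) (abs_nonneg _)
    · have h1 := abs_sub u v
      rw [abs_of_neg hv0] at h1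
      nlinarith [abs_nonneg u]
  have := mul_sub_le_integral_of_le (by linarith) hi (convIntegrand_nonneg β γ s u) h
  refine le_trans (le_of_eq ?_) this
  rw [Real.rpow_add hs, Real.rpow_one]
  ring

/-- Lower bound for a positive first exponent. -/
lemma convIntegrand_lower_of_pos {β γ s T u : ℝ} (hβ : 0 < β) (hβ1 : β ≤ 1) (hγ : γ < 0)
    (hs : 0 < s) (hsT : s ≤ T) (hi : Integrable (convIntegrand β γ s u)) :
    (2 + T) ^ (β - 1) * 3 ^ γ * s * (1 + |u|) ^ (γ + β) ≤ ∫ v, convIntegrand β γ s u v := by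
  set R : ℝ := 1 + |u| with hR
  have hR1 : 1 ≤ R := by rw [hR]; linarith [abs_nonneg u]
  have hR0 : 0 < R := by linarith
  have hT : 0 < 2 + T := by linarith
  have h : ∀ v ∈ Set.Ioo R (2 * R),
      s * ((2 + T) ^ (β - 1) * R ^ (β - 1)) * (3 ^ γ * R ^ γ) ≤ convIntegrand β γ s u v := by
    rintro v ⟨hv, hv2⟩
    have hv0 : 0 < v := by linarith
    refine mul_le_mul ?_ (le_truncPow_of_le hγ.le hR0 (by norm_num) ?_)
      (by positivity) (abs_nonneg _)
    · refine le_trans ?_ (le_abs_fracKernel_neg_of_pos hβ.ne' hβ1 hs hv0)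
      rw [← Real.mul_rpow hT.le hR0.le]
      refine mul_le_mul_of_nonneg_left (Real.rpow_le_rpow_of_nonpos (by linarith) ?_
        (by linarith)) hs.le
      nlinarith
    · have h1 := abs_sub u v
      rw [abs_of_pos hv0] at h1
      linarith
  have := mul_sub_le_integral_of_le (by linarith) hi (convIntegrand_nonneg β γ s u) h
  refine le_trans (le_of_eq ?_) this
  have e : R ^ (γ + β) = R ^ (β - 1) * R ^ γ * R := by
    rw [← Real.rpow_add hR0, ← Real.rpow_add_one hR0.ne']; congr 1; ring
  rw [e]
  ring

/-- Passing from `(1 + |u|)^δ` to the truncated power in a two-sided bound. -/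
lemma exists_truncPow_bounds {δ c C T p : ℝ} {F : ℝ → ℝ → ℝ} (hδ : δ ≤ 0) (hc : 0 < c)
    (h : ∀ s, 0 < s → s ≤ T → ∀ u, c * s ^ p * (1 + |u|) ^ δ ≤ F s u ∧
      F s u ≤ C * s ^ p * (1 + |u|) ^ δ) :
    ∃ c C : ℝ, 0 < c ∧ c ≤ C ∧ ∀ s, 0 < s → s ≤ T → ∀ u,
      c * s ^ p * truncPow 0 δ u ≤ F s u ∧ F s u ≤ C * s ^ p * truncPow 0 δ u := by
  have h2 : (0 : ℝ) < 2 ^ δ := by positivity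
  refine ⟨c * 2 ^ δ, max (c * 2 ^ δ) C, by positivity, le_max_left _ _,
    fun s hs hsT u => ⟨?_, ?_⟩⟩
  · refine le_trans ?_ (h s hs hsT u).1
    have h3 := truncPow_le_one_add_abs_rpow hδ u
    rw [Real.rpow_neg two_pos.le, ← div_eq_inv_mul, le_div_iff₀ h2] at h3
    have := mul_le_mul_of_nonneg_left h3 (show 0 ≤ c * s ^ p by positivity)
    linarith
  · refine (h s hs hsT u).2.trans ?_
    have h0 : 0 < max (c * 2 ^ δ) C := lt_max_of_lt_left (by positivity)
    have := le_max_right (c * 2 ^ δ) C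
    have h3 := one_add_abs_rpow_le_truncPow hδ u
    gcongr

/-- Two-sided bound: uniformly in `s ∈ (0, T]` and `u ∈ ℝ`,
`∫ |k_s^{β₁}(−v)| |u−v|^{0, n(β₂−1)} dv ≈ s^{1+min(β₁,0)} |u|^{0, n(β₂−1)+max(β₁,0)}`,
with constants depending only on `n, β₁, β₂, T`. -/
theorem convolution_fracKernel_truncPow_two_sided
    (n : ℕ) (hn : 1 ≤ n) (β₁ β₂ T : ℝ) (hβ₁ : β₁ ≠ 0) (hT : 0 < T)
    (hβ₂ : 1 - 1 / (n : ℝ) < β₂ ∧ β₂ < 1)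
    (α : ℝ) (hα : α = β₁ + ((n : ℝ) / 2) * (β₂ - 1) + 1) (hα0 : 0 < α) (hα1 : α < 1) :
    ∃ c C : ℝ, 0 < c ∧ c ≤ C ∧ ∀ s : ℝ, 0 < s → s ≤ T → ∀ u : ℝ,
      c * s ^ (1 + min β₁ 0) * truncPow 0 ((n : ℝ) * (β₂ - 1) + max β₁ 0) u ≤
        (∫ v : ℝ, |fracKernel β₁ s (-v)| * truncPow 0 ((n : ℝ) * (β₂ - 1)) (u - v)) ∧
      (∫ v : ℝ, |fracKernel β₁ s (-v)| * truncPow 0 ((n : ℝ) * (β₂ - 1)) (u - v)) ≤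
        C * s ^ (1 + min β₁ 0) * truncPow 0 ((n : ℝ) * (β₂ - 1) + max β₁ 0) u := by
  have hn0 : (0 : ℝ) < n := by exact_mod_cast hn
  have hγ : (n : ℝ) * (β₂ - 1) < 0 := mul_neg_of_pos_of_neg hn0 (by linarith [hβ₂.2])
  have hγ1 : -1 < (n : ℝ) * (β₂ - 1) := by
    have := mul_lt_mul_of_pos_left hβ₂.1 hn0
    rw [mul_sub, mul_one_div_cancel hn0.ne'] at this
    linarith
  have hlo : -1 < β₁ := by linarith
  have hup : β₁ + (n : ℝ) * (β₂ - 1) < 0 := by linarith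
  generalize (n : ℝ) * (β₂ - 1) = γ at *
  rcases lt_or_gt_of_ne hβ₁ with hneg | hpos
  · obtain ⟨C, hC⟩ := convIntegrand_upper_of_neg hneg hlo hγ hγ1 hT
    rw [min_eq_left hneg.le, max_eq_right hneg.le, add_zero]
    have hc : 0 < (1 + T) ^ γ / |β₁| := by positivity
    exact exists_truncPow_bounds (F := fun s u => ∫ v, convIntegrand β₁ γ s u v) hγ.le hc
      fun s hs hsT u =>
        ⟨convIntegrand_lower_of_neg hneg hγ hs hsT (hC s hs hsT u).1, (hC s hs hsT u).2⟩
  · obtain ⟨C, hC⟩ := convIntegrand_upper_of_pos hpos hup hγ1 hT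
    rw [min_eq_right hpos.le, max_eq_left hpos.le, add_zero]
    have hc : 0 < (2 + T) ^ (β₁ - 1) * 3 ^ γ := by positivity
    refine exists_truncPow_bounds (C := C) (F := fun s u => ∫ v, convIntegrand β₁ γ s u v)
      (by linarith) hc fun s hs hsT u => ?_
    rw [Real.rpow_one]
    exact ⟨convIntegrand_lower_of_pos hpos (by linarith) hγ hs hsT (hC s hs hsT u).1,
      (hC s hs hsT u).2⟩
end
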